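/- arXiv:2207.08788 — 3 statements merged into one kernel-verified Lean document; each statement's English description precedes it below -/
import Mathlib

section
/- Let p be a prime, f ≥ 1, and q = p^f a prime power with q ≥ 17. Let G = PSL₂(q), the quotient of SL₂(𝔽_q) by its center, and suppose that G acts transitively, faithfully and with fixity 4 on a finite set Ω; let α ∈ Ω. Then p is odd, and one of the following holds: (i) q ≡ 1 (mod 4), and either G_α is cyclic of order (q−1)/4, or G_α contains a normal subgroup E that is abelian of order q with every element satisfying x^p = 1, together with a cyclic subgroup C of order (q−1)/4 such that E ∩ C = 1 and EC = G_α; (ii) q ≡ 3 (mod 4) and G_α is cyclic of order (q+1)/4. -/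
/-- `PSL₂(F)`: the quotient of `SL₂(F)` by its center. -/
abbrev PSL2 (F : Type*) [Field F] :=
  Matrix.SpecialLinearGroup (Fin 2) F ⧸ Subgroup.center (Matrix.SpecialLinearGroup (Fin 2) F)

section ClassCounting

open Finset

set_option linter.unusedSectionVars false

variable {K : Type*} [Group K] [Fintype K]

open Classical in
/-- The `K`-conjugates of the elements outside `Z` that commute with `g`. -/
noncomputable def torusOrbit (Z : Subgroup K) (g : K) : Finset K :=
  univ.filter fun y => ∃ k x, Commute x g ∧ x ∉ Z ∧ k * x * k⁻¹ = y

open Classical in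
/-- The order of the centralizer of `g`. -/
noncomputable def centCard (g : K) : ℕ := (univ.filter fun x : K => Commute x g).card

lemma mem_torusOrbit {Z : Subgroup K} {g y : K} :
    y ∈ torusOrbit Z g ↔ ∃ k x, Commute x g ∧ x ∉ Z ∧ k * x * k⁻¹ = y := by
  simp [torusOrbit]

/-- Outside the central subgroup `Z`, commuting is transitive, and an element fuses inside its
centralizer at most with its inverse, from which it is distinct. -/
structure IsTorusPartition (Z : Subgroup K) : Prop where
  central : ∀ z ∈ Z, ∀ x : K, Commute z x
  trans : ∀ g x y : K, g ∉ Z → Commute x g → Commute y g → Commute x y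
  fuse : ∀ g k : K, g ∉ Z → Commute (k * g * k⁻¹) g → k * g * k⁻¹ = g ∨ k * g * k⁻¹ = g⁻¹
  inv_ne : ∀ g : K, g ∉ Z → g⁻¹ ≠ g

namespace IsTorusPartition

variable {Z : Subgroup K}

lemma conj_notMem (h : IsTorusPartition Z) {x : K} (hx : x ∉ Z) (k : K) : k * x * k⁻¹ ∉ Z := by
  intro hk
  apply hx
  have := (h.central _ hk k).eq
  have e : x = k * x * k⁻¹ := by
    have : k * x * k⁻¹ * k = k * (k * x * k⁻¹) := this
    have h2 : k * x = k * (k * x * k⁻¹) := by simpa using this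
    exact mul_left_cancel h2
  rw [e]; exact hk

lemma conj_notMem' (h : IsTorusPartition Z) {x : K} (hx : x ∉ Z) (k : K) : k⁻¹ * x * k ∉ Z := by
  simpa using h.conj_notMem hx k⁻¹

lemma torusOrbit_notMem (h : IsTorusPartition Z) {g y : K} (hy : y ∈ torusOrbit Z g) : y ∉ Z := by
  obtain ⟨k, x, -, hx, rfl⟩ := mem_torusOrbit.1 hy
  exact h.conj_notMem hx k

open Classical in
lemma card_filter_conj (g k₀ : K) :
    (univ.filter fun k : K => k * g * k⁻¹ = k₀ * g * k₀⁻¹).card = centCard g := by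
  refine Finset.card_bij (fun k _ => k₀⁻¹ * k) ?_ ?_ ?_
  · intro k hk
    have hk := (mem_filter.1 hk).2
    refine mem_filter.2 ⟨mem_univ _, ?_⟩
    show k₀⁻¹ * k * g = g * (k₀⁻¹ * k)
    calc k₀⁻¹ * k * g = k₀⁻¹ * (k * g * k⁻¹) * k := by group
      _ = g * (k₀⁻¹ * k) := by rw [hk]; group
  · intro a _ b _ hab; exact mul_left_cancel hab
  · intro m hm
    have hm : m * g = g * m := (mem_filter.1 hm).2
    refine ⟨k₀ * m, mem_filter.2 ⟨mem_univ _, ?_⟩, by group⟩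
    calc k₀ * m * g * (k₀ * m)⁻¹ = k₀ * (m * g) * m⁻¹ * k₀⁻¹ := by group
      _ = _ := by rw [hm]; group

open Classical in
lemma card_conjugates (g : K) :
    (univ.filter fun y : K => ∃ k, k * g * k⁻¹ = y).card * centCard g = Fintype.card K := by
  have := Finset.card_eq_sum_card_fiberwise (s := (univ : Finset K)) (f := fun k => k * g * k⁻¹)
    (t := univ.filter fun y : K => ∃ k, k * g * k⁻¹ = y) (by intro k _; simp)
  rw [← Finset.card_univ, this, Finset.sum_const_nat]
  intro y hy
  obtain ⟨k₀, rfl⟩ := (mem_filter.1 hy).2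
  exact card_filter_conj g k₀

open Classical in
lemma card_normalizing_of_real (h : IsTorusPartition Z) {g : K} (hg : g ∉ Z)
    (hr : ∃ k, k * g * k⁻¹ = g⁻¹) :
    (univ.filter fun k : K => k * g * k⁻¹ = g ∨ k * g * k⁻¹ = g⁻¹).card = 2 * centCard g := by
  obtain ⟨k₀, hk₀⟩ := hr
  rw [Finset.filter_or, Finset.card_union_of_disjoint, two_mul]
  · congr 1
    · simpa using card_filter_conj g 1
    · simpa [hk₀] using card_filter_conj g k₀
  · rw [Finset.disjoint_filter]
    intro x _ h1 h2
    exact h.inv_ne g hg (h2.symm.trans h1)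

open Classical in
lemma card_normalizing_of_not_real {g : K}
    (hr : ¬ ∃ k, k * g * k⁻¹ = g⁻¹) :
    (univ.filter fun k : K => k * g * k⁻¹ = g ∨ k * g * k⁻¹ = g⁻¹).card = centCard g := by
  push Not at hr
  simpa [hr] using card_filter_conj g 1

open Classical in
lemma card_centralizing_diff (h : IsTorusPartition Z) (g : K) :
    (univ.filter fun x : K => Commute x g ∧ x ∉ Z).card + Nat.card Z = centCard g := by
  have e : (univ.filter fun x : K => x ∈ Z).card = Nat.card Z := by
    rw [Nat.card_eq_fintype_card, Fintype.card_subtype]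
  rw [← e, ← Finset.card_union_of_disjoint, centCard]
  · congr 1
    ext x
    simp only [mem_union, mem_filter, mem_univ, true_and]
    have := fun hx => h.central x hx g
    tauto
  · rw [Finset.disjoint_filter]; tauto

open Classical in
lemma card_torusOrbit_mul (h : IsTorusPartition Z) {g : K} (hg : g ∉ Z) :
    (torusOrbit Z g).card * (univ.filter fun k : K => k * g * k⁻¹ = g ∨ k * g * k⁻¹ = g⁻¹).card =
      Fintype.card K * (univ.filter fun x : K => Commute x g ∧ x ∉ Z).card := by
  have hmaps : Set.MapsTo (fun p : K × K => p.1 * p.2 * p.1⁻¹)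
      ((univ : Finset K) ×ˢ univ.filter fun x : K => Commute x g ∧ x ∉ Z : Finset (K × K))
      (torusOrbit Z g) := by
    rintro ⟨k, x⟩ hk
    simp only [coe_product, Set.mem_prod, mem_coe, mem_filter, mem_univ, true_and] at hk
    exact mem_torusOrbit.2 ⟨k, x, hk.1, hk.2, rfl⟩
  rw [← Finset.card_univ (α := K),
    ← Finset.card_product univ (univ.filter fun x : K => Commute x g ∧ x ∉ Z),
    Finset.card_eq_sum_card_fiberwise hmaps, Finset.sum_const_nat]
  · intro y hy
    obtain ⟨k₀, x₀, hc, hx, rfl⟩ := mem_torusOrbit.1 hy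
    symm
    refine Finset.card_bij (fun m _ => (k₀ * m, m⁻¹ * x₀ * m)) ?_ ?_ ?_
    · intro m hm
      simp only [mem_filter, mem_univ, true_and, mem_product] at hm ⊢
      refine ⟨⟨?_, h.conj_notMem' hx m⟩, by group⟩
      have hc' : Commute x₀ (m * g * m⁻¹) := by
        rcases hm with e | e <;> rw [e]
        · exact hc
        · exact hc.inv_right
      have e1 : x₀ * (m * g * m⁻¹) = (m * g * m⁻¹) * x₀ := hc'
      show m⁻¹ * x₀ * m * g = g * (m⁻¹ * x₀ * m)
      calc m⁻¹ * x₀ * m * g = m⁻¹ * (x₀ * (m * g * m⁻¹)) * m := by group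
        _ = g * (m⁻¹ * x₀ * m) := by rw [e1]; group
    · intro a _ b _ hab
      exact mul_left_cancel (Prod.ext_iff.1 hab).1
    · rintro ⟨k, x⟩ hk
      simp only [mem_filter, mem_univ, true_and, mem_product] at hk
      obtain ⟨⟨hxc, hxZ⟩, he⟩ := hk
      have e2 : (k₀⁻¹ * k) * x * (k₀⁻¹ * k)⁻¹ = x₀ := by
        calc (k₀⁻¹ * k) * x * (k₀⁻¹ * k)⁻¹ = k₀⁻¹ * (k * x * k⁻¹) * k₀ := by group
          _ = x₀ := by rw [he]; group
      have e3 : x = (k₀⁻¹ * k)⁻¹ * x₀ * (k₀⁻¹ * k) := by rw [← e2]; group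
      refine ⟨k₀⁻¹ * k, ?_, ?_⟩
      · simp only [mem_filter, mem_univ, true_and]
        apply h.fuse g _ hg
        refine h.trans x₀ _ _ hx ?_ hc.symm
        rw [← e2]
        exact (Commute.conj_iff _).2 hxc.symm
      · ext
        · simp
        · exact e3.symm

lemma card_torusOrbit_of_real (h : IsTorusPartition Z) {g : K} (hg : g ∉ Z)
    (hr : ∃ k, k * g * k⁻¹ = g⁻¹) :
    ((torusOrbit Z g).card : ℚ) =
      Fintype.card K * (1 / 2 - (Nat.card Z : ℚ) / (2 * centCard g)) := by
  classical
  have h1 := h.card_torusOrbit_mul hg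
  have h2 := h.card_centralizing_diff g
  rw [h.card_normalizing_of_real hg hr] at h1
  have hpos : 0 < centCard g := card_pos.2 ⟨1, by simp⟩
  have h1' : ((torusOrbit Z g).card : ℚ) * (2 * centCard g) =
    Fintype.card K * (univ.filter fun x : K => Commute x g ∧ x ∉ Z).card := by exact_mod_cast h1
  have h2' : ((univ.filter fun x : K => Commute x g ∧ x ∉ Z).card : ℚ) + Nat.card Z = centCard g := by
    exact_mod_cast h2
  have h3 : (0 : ℚ) < centCard g := by exact_mod_cast hpos
  rw [eq_sub_of_add_eq h2'] at h1'
  field_simp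
  linear_combination h1'

lemma card_torusOrbit_of_not_real (h : IsTorusPartition Z) {g : K} (hg : g ∉ Z)
    (hr : ¬ ∃ k, k * g * k⁻¹ = g⁻¹) :
    ((torusOrbit Z g).card : ℚ) =
      Fintype.card K * (1 - (Nat.card Z : ℚ) / centCard g) := by
  classical
  have h1 := h.card_torusOrbit_mul hg
  have h2 := h.card_centralizing_diff g
  rw [card_normalizing_of_not_real hr] at h1
  have hpos : 0 < centCard g := card_pos.2 ⟨1, by simp⟩
  have h1' : ((torusOrbit Z g).card : ℚ) * (centCard g) =
    Fintype.card K * (univ.filter fun x : K => Commute x g ∧ x ∉ Z).card := by exact_mod_cast h1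
  have h2' : ((univ.filter fun x : K => Commute x g ∧ x ∉ Z).card : ℚ) + Nat.card Z = centCard g := by
    exact_mod_cast h2
  have h3 : (0 : ℚ) < centCard g := by exact_mod_cast hpos
  rw [eq_sub_of_add_eq h2'] at h1'
  field_simp
  linear_combination h1'

lemma disjoint_torusOrbit (h : IsTorusPartition Z) {g g' : K} (hg' : g' ∉ Z)
    (hn : g' ∉ torusOrbit Z g) : Disjoint (torusOrbit Z g) (torusOrbit Z g') := by
  rw [Finset.disjoint_left]
  intro y hy hy'
  obtain ⟨k, x, hc, hx, rfl⟩ := mem_torusOrbit.1 hy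
  obtain ⟨k', x', hc', hx', he⟩ := mem_torusOrbit.1 hy'
  apply hn
  have e : x' = (k'⁻¹ * k) * x * (k'⁻¹ * k)⁻¹ := by
    calc x' = k'⁻¹ * (k' * x' * k'⁻¹) * k' := by group
      _ = _ := by rw [he]; group
  have c1 : Commute ((k'⁻¹ * k) * g * (k'⁻¹ * k)⁻¹) x' := by
    rw [e]; exact (Commute.conj_iff _).2 hc.symm
  have c2 : Commute g' ((k'⁻¹ * k) * g * (k'⁻¹ * k)⁻¹) := h.trans x' _ _ hx' hc'.symm c1
  refine mem_torusOrbit.2 ⟨k'⁻¹ * k, (k'⁻¹ * k)⁻¹ * g' * (k'⁻¹ * k), ?_,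
    h.conj_notMem' hg' _, by group⟩
  have := (Commute.conj_iff (k'⁻¹ * k)⁻¹).2 c2
  convert this using 1 <;> group

open Classical in
lemma conjugates_subset_torusOrbit {g x : K} (hc : Commute x g) (hx : x ∉ Z) :
    (univ.filter fun y : K => ∃ k, k * x * k⁻¹ = y) ⊆ torusOrbit Z g := by
  intro y hy
  obtain ⟨k, hk⟩ := (mem_filter.1 hy).2
  exact mem_torusOrbit.2 ⟨k, x, hc, hx, hk⟩

lemma centCard_eq (h : IsTorusPartition Z) {g x : K} (hg : g ∉ Z) (hx : x ∉ Z)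
    (hc : Commute x g) : centCard x = centCard g := by
  classical
  rw [centCard, centCard]
  congr 1
  ext y
  simp only [mem_filter, mem_univ, true_and]
  exact ⟨fun hy => h.trans x y g hx hy hc.symm, fun hy => h.trans g y x hg hy hc⟩

lemma centCard_pos (g : K) : 0 < centCard g := by
  classical
  exact card_pos.2 ⟨1, by simp⟩

lemma centCard_eq_natCard (g : K) : centCard g = Nat.card (Subgroup.centralizer {g}) := by
  classical
  rw [centCard, Nat.card_eq_fintype_card, Fintype.card_subtype]
  congr 1
  ext x
  simp only [mem_filter, mem_univ, true_and, Subgroup.mem_centralizer_singleton_iff]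
  exact Iff.rfl

lemma centCard_dvd (g : K) : centCard g ∣ Fintype.card K := by
  rw [centCard_eq_natCard, ← Nat.card_eq_fintype_card]
  exact Subgroup.card_subgroup_dvd_card _

lemma card_dvd_centCard (h : IsTorusPartition Z) (g : K) : Nat.card Z ∣ centCard g := by
  rw [centCard_eq_natCard]
  apply Subgroup.card_dvd_of_le
  intro z hz
  rw [Subgroup.mem_centralizer_singleton_iff]
  exact h.central z hz g

lemma two_mul_card_le_centCard (h : IsTorusPartition Z) {g : K} (hg : g ∉ Z) :
    2 * Nat.card Z ≤ centCard g := by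
  classical
  obtain ⟨m, hm⟩ := h.card_dvd_centCard g
  have h2 := h.card_centralizing_diff g
  have h3 : 0 < (univ.filter fun x : K => Commute x g ∧ x ∉ Z).card :=
    card_pos.2 ⟨g, by simp [hg]⟩
  have : 2 ≤ m := by
    by_contra hlt
    have : m ≤ 1 := by omega
    have : Nat.card Z * m ≤ Nat.card Z * 1 := Nat.mul_le_mul_left _ this
    omega
  rw [hm, mul_comm]
  exact Nat.mul_le_mul_left _ this

lemma two_mul_centCard_le (h : IsTorusPartition Z) {g : K} (hg : g ∉ Z)
    (hr : ∃ k, k * g * k⁻¹ = g⁻¹) : 2 * centCard g ≤ Fintype.card K := by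
  classical
  rw [← h.card_normalizing_of_real hg hr]
  exact card_le_univ _

open Classical in
lemma card_notMem (Z : Subgroup K) :
    (univ.filter fun x : K => x ∉ Z).card + Nat.card Z = Fintype.card K := by
  have e : (univ.filter fun x : K => x ∈ Z).card = Nat.card Z := by
    rw [Nat.card_eq_fintype_card, Fintype.card_subtype]
  rw [← e, add_comm, Finset.card_filter_add_card_filter_not, card_univ]

lemma exists_notMem_of_card_lt {s : Finset K} (hs : s.card + Nat.card Z < Fintype.card K) :
    ∃ g, g ∉ Z ∧ g ∉ s := by
  classical
  by_contra! hall
  have : (univ.filter fun x : K => x ∉ Z).card ≤ s.card :=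
    card_le_card fun x hx => hall x (mem_filter.1 hx).2
  have := card_notMem Z
  omega

lemma card_add_le {s : Finset K} (hs : ∀ x ∈ s, x ∉ Z) :
    s.card + Nat.card Z ≤ Fintype.card K := by
  classical
  rw [← card_notMem Z]
  gcongr
  exact fun x hx => mem_filter.2 ⟨mem_univ _, hs x hx⟩

variable {T : Type*} {tr : K → T} {m : ℕ}

open Classical in
lemma le_of_fiber_bound {g : K} {r : ℕ} (s : Finset K)
    (hI : m * (univ.filter fun x => tr x = tr g).card ≤ 4 * Fintype.card K)
    (hs : ∀ x ∈ s, tr x = tr g) (hr : r * Fintype.card K = s.card * centCard g) :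
    r * m ≤ 4 * centCard g := by
  have h1 : s.card ≤ (univ.filter fun x => tr x = tr g).card :=
    card_le_card fun x hx => mem_filter.2 ⟨mem_univ _, hs x hx⟩
  have h2 : m * s.card ≤ 4 * Fintype.card K := (Nat.mul_le_mul_left _ h1).trans hI
  have h3 : 0 < Fintype.card K := Fintype.card_pos
  refine Nat.le_of_mul_le_mul_left ?_ h3
  calc Fintype.card K * (r * m) = m * s.card * centCard g := by
        rw [mul_assoc m, ← hr]; ring
    _ ≤ 4 * Fintype.card K * centCard g := Nat.mul_le_mul_right _ h2
    _ = _ := by ring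

open Classical in
lemma le_four_mul_centCard (hconj : ∀ k x, tr (k * x * k⁻¹) = tr x) {g : K}
    (hI : m * (univ.filter fun x => tr x = tr g).card ≤ 4 * Fintype.card K) :
    m ≤ 4 * centCard g := by
  rw [← one_mul m]
  refine le_of_fiber_bound (univ.filter fun y : K => ∃ k, k * g * k⁻¹ = y) hI ?_
    (by rw [card_conjugates, one_mul])
  intro x hx
  obtain ⟨k, rfl⟩ := (mem_filter.1 hx).2
  exact hconj k g

open Classical in
lemma le_two_mul_centCard (hconj : ∀ k x, tr (k * x * k⁻¹) = tr x)
    (hinv : ∀ x, tr x⁻¹ = tr x) {g : K} (hr : ¬ ∃ k, k * g * k⁻¹ = g⁻¹)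
    (hI : m * (univ.filter fun x => tr x = tr g).card ≤ 4 * Fintype.card K) :
    m ≤ 2 * centCard g := by
  have e : centCard g⁻¹ = centCard g := by
    rw [centCard, centCard]; congr 1; ext x; simp [Commute.inv_right_iff]
  have hd : Disjoint (univ.filter fun y : K => ∃ k, k * g * k⁻¹ = y)
      (univ.filter fun y : K => ∃ k, k * g⁻¹ * k⁻¹ = y) := by
    rw [Finset.disjoint_filter]
    rintro y - ⟨k, rfl⟩ ⟨l, hl⟩
    refine hr ⟨l⁻¹ * k, ?_⟩
    calc l⁻¹ * k * g * (l⁻¹ * k)⁻¹ = l⁻¹ * (k * g * k⁻¹) * l := by group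
      _ = g⁻¹ := by rw [← hl]; group
  have := le_of_fiber_bound (r := 2) ((univ.filter fun y : K => ∃ k, k * g * k⁻¹ = y) ∪
      (univ.filter fun y : K => ∃ k, k * g⁻¹ * k⁻¹ = y)) hI ?_ ?_
  · omega
  · intro x hx
    rcases mem_union.1 hx with hx | hx <;> obtain ⟨k, rfl⟩ := (mem_filter.1 hx).2
    · exact hconj k g
    · rw [hconj, hinv]
  · rw [card_union_of_disjoint hd, add_mul, card_conjugates, ← e, card_conjugates, two_mul]

open Classical in
lemma two_orbit_bound (h : IsTorusPartition Z) (hconj : ∀ k x, tr (k * x * k⁻¹) = tr x)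
    {g g' x x' : K} (hg : g ∉ Z) (hg' : g' ∉ Z) (hn : g' ∉ torusOrbit Z g)
    (hc : Commute x g) (hx : x ∉ Z) (hc' : Commute x' g') (hx' : x' ∉ Z) (htr : tr x' = tr x)
    (hI : m * (univ.filter fun y => tr y = tr x).card ≤ 4 * Fintype.card K) :
    (m : ℚ) * (1 / centCard g + 1 / centCard g') ≤ 4 := by
  have hd : Disjoint (univ.filter fun y : K => ∃ k, k * x * k⁻¹ = y)
      (univ.filter fun y : K => ∃ k, k * x' * k⁻¹ = y) :=
    Finset.disjoint_of_subset_left (conjugates_subset_torusOrbit hc hx)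
      (Finset.disjoint_of_subset_right (conjugates_subset_torusOrbit hc' hx')
        (h.disjoint_torusOrbit hg' hn))
  have h1 : (univ.filter fun y : K => ∃ k, k * x * k⁻¹ = y).card +
      (univ.filter fun y : K => ∃ k, k * x' * k⁻¹ = y).card ≤
      (univ.filter fun y => tr y = tr x).card := by
    rw [← card_union_of_disjoint hd]
    apply card_le_card
    intro y hy
    rcases mem_union.1 hy with hy | hy <;> obtain ⟨k, rfl⟩ := (mem_filter.1 hy).2
    · simp [hconj]
    · simp [hconj, htr]
  have h2 := card_conjugates x
  have h3 := card_conjugates x'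
  rw [h.centCard_eq hg hx hc] at h2
  rw [h.centCard_eq hg' hx' hc'] at h3
  have p1 : (0 : ℚ) < centCard g := by exact_mod_cast centCard_pos g
  have p2 : (0 : ℚ) < centCard g' := by exact_mod_cast centCard_pos g'
  have p3 : (0 : ℚ) < Fintype.card K := by exact_mod_cast Fintype.card_pos
  have h2' : ((univ.filter fun y : K => ∃ k, k * x * k⁻¹ = y).card : ℚ) =
      Fintype.card K * (1 / centCard g) := by
    field_simp; exact_mod_cast h2
  have h3' : ((univ.filter fun y : K => ∃ k, k * x' * k⁻¹ = y).card : ℚ) =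
      Fintype.card K * (1 / centCard g') := by
    field_simp; exact_mod_cast h3
  have h1' := (Nat.mul_le_mul_left m h1).trans hI
  have h1'' : (m : ℚ) * ((univ.filter fun y : K => ∃ k, k * x * k⁻¹ = y).card +
      (univ.filter fun y : K => ∃ k, k * x' * k⁻¹ = y).card) ≤ 4 * Fintype.card K := by
    exact_mod_cast h1'
  rw [h2', h3'] at h1''
  refine le_of_mul_le_mul_left ?_ p3
  linarith

lemma exists_sq_mem_of_four_dvd (hZ : Nat.card Z = 2) {g : K} (h4 : 4 ∣ centCard g) :
    ∃ x, Commute x g ∧ x ∉ Z ∧ x ^ 2 ∈ Z := by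
  have : Fact (Nat.Prime 2) := ⟨Nat.prime_two⟩
  rw [centCard_eq_natCard] at h4
  obtain ⟨P, hP⟩ := Sylow.exists_subgroup_card_pow_prime 2 (n := 2)
    (G := Subgroup.centralizer {g}) (by simpa using h4)
  have hPc : Nat.card (P.map (Subgroup.centralizer {g}).subtype) = 4 := by
    rw [Subgroup.card_map_of_injective (Subgroup.subtype_injective _), hP]
    norm_num
  have hns : ¬ P.map (Subgroup.centralizer {g}).subtype ≤ Z := by
    intro hle
    have := Subgroup.card_dvd_of_le hle
    rw [hPc, hZ] at this
    omega
  obtain ⟨x, hxP, hxZ⟩ := SetLike.not_le_iff_exists.1 hns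
  have hx4 : x ^ 4 = 1 := by
    have := pow_card_eq_one' (x := (⟨x, hxP⟩ : P.map (Subgroup.centralizer {g}).subtype))
    rw [hPc] at this
    simpa using congrArg Subtype.val this
  obtain ⟨y, -, rfl⟩ := hxP
  have hc : Commute (y : K) g := Subgroup.mem_centralizer_singleton_iff.1 y.2
  by_cases h2 : (y : K) ^ 2 ∈ Z
  · exact ⟨y, hc, hxZ, h2⟩
  · refine ⟨(y : K) ^ 2, hc.pow_left 2, h2, ?_⟩
    rw [← pow_mul]
    have : (y : K) ^ 4 = 1 := hx4
    norm_num [this]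

lemma exists_pow_three_of_three_dvd (hZ : Nat.card Z = 2) {g : K} (h3 : 3 ∣ centCard g) :
    ∃ x, Commute x g ∧ x ∉ Z ∧ x ^ 3 = 1 := by
  have : Fact (Nat.Prime 3) := ⟨Nat.prime_three⟩
  rw [centCard_eq_natCard] at h3
  obtain ⟨y, hy⟩ := exists_prime_orderOf_dvd_card' 3 h3
  have hy3 : (y : K) ^ 3 = 1 := by
    have := pow_orderOf_eq_one y
    rw [hy] at this
    simpa using congrArg Subtype.val this
  refine ⟨y, Subgroup.mem_centralizer_singleton_iff.1 y.2, ?_, hy3⟩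
  intro hyZ
  have h2 : (y : K) ^ 2 = 1 := by
    have := pow_card_eq_one' (x := (⟨y, hyZ⟩ : Z))
    rw [hZ] at this
    simpa using congrArg Subtype.val this
  have h1 : (y : K) = 1 := by
    have : (y : K) ^ 3 = (y : K) ^ 2 * y := pow_succ _ _
    rw [hy3, h2, one_mul] at this
    exact this.symm
  have : y = 1 := Subtype.ext h1
  rw [this] at hy
  simp at hy

open Classical in
theorem exists_forall_commute (h : IsTorusPartition Z) (hne : ∃ g, g ∉ Z) (hm : 16 ≤ m)
    (hconj : ∀ k x, tr (k * x * k⁻¹) = tr x) (hinv : ∀ x, tr x⁻¹ = tr x)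
    (hI : ∀ g ∉ Z, m * (univ.filter fun x => tr x = tr g).card ≤ 4 * Fintype.card K)
    (hZ : Nat.card Z ≤ 2)
    (hreal : ∀ g ∉ Z, (∃ k, k * g * k⁻¹ = g⁻¹) → Nat.card Z = 2)
    {t₀ t₁ : T} (ht₀ : ∀ x ∉ Z, x ^ 2 ∈ Z → tr x = t₀) (ht₁ : ∀ x ∉ Z, x ^ 3 = 1 → tr x = t₁)
    (h5 : m = 16 → ¬ 5 ∣ Fintype.card K) :
    ∃ g, g ∉ Z ∧ (∀ x, Commute x g) ∧ m ≤ 2 * Fintype.card K := by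
  have pN : (0 : ℚ) < Fintype.card K := by exact_mod_cast Fintype.card_pos
  have pZ : 0 < Nat.card Z := Nat.card_pos
  have hZq : (Nat.card Z : ℚ) ≤ 2 := by exact_mod_cast hZ
  have pZq : (0 : ℚ) < Nat.card Z := by exact_mod_cast pZ
  have pos : ∀ g : K, (0 : ℚ) < centCard g := fun g => by exact_mod_cast centCard_pos g
  by_cases hnr : ∃ g, g ∉ Z ∧ ¬ ∃ k, k * g * k⁻¹ = g⁻¹
  · obtain ⟨g, hg, hr⟩ := hnr
    have hO := h.card_torusOrbit_of_not_real hg hr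
    have hτ := le_two_mul_centCard hconj hinv hr (hI g hg)
    have h8 : (8 : ℚ) ≤ centCard g := by
      have : 8 ≤ centCard g := by omega
      exact_mod_cast this
    have hle := card_add_le (Z := Z) fun x hx => h.torusOrbit_notMem (g := g) hx
    rcases hle.lt_or_eq with hlt | heq
    · exfalso
      obtain ⟨g₂, hg₂, hn⟩ := exists_notMem_of_card_lt hlt
      have hle2 := card_add_le (Z := Z) (s := torusOrbit Z g ∪ torusOrbit Z g₂) fun x hx => by
        rcases mem_union.1 hx with hx | hx <;> exact h.torusOrbit_notMem hx
      rw [card_union_of_disjoint (h.disjoint_torusOrbit hg₂ hn)] at hle2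
      have hle2' : ((torusOrbit Z g).card : ℚ) + (torusOrbit Z g₂).card + Nat.card Z ≤
        Fintype.card K := by exact_mod_cast hle2
      have hz2 : (2 : ℚ) * Nat.card Z ≤ centCard g₂ := by
        exact_mod_cast h.two_mul_card_le_centCard hg₂
      have hb1 : (Nat.card Z : ℚ) / centCard g ≤ 1 / 4 := by
        rw [div_le_div_iff₀ (pos g) (by norm_num)]; linarith
      have hb2 : (Nat.card Z : ℚ) / centCard g₂ ≤ 1 / 2 := by
        rw [div_le_div_iff₀ (pos g₂) (by norm_num)]; linarith
      have hO2 : (Fintype.card K : ℚ) * (1 / 4) ≤ (torusOrbit Z g₂).card := by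
        by_cases hr2 : ∃ k, k * g₂ * k⁻¹ = g₂⁻¹
        · rw [h.card_torusOrbit_of_real hg₂ hr2]
          refine mul_le_mul_of_nonneg_left ?_ pN.le
          have : (Nat.card Z : ℚ) / (2 * centCard g₂) = (Nat.card Z / centCard g₂) / 2 := by
            field_simp
          rw [this]; linarith
        · rw [h.card_torusOrbit_of_not_real hg₂ hr2]
          refine mul_le_mul_of_nonneg_left ?_ pN.le
          linarith
      have hO1 : (Fintype.card K : ℚ) * (3 / 4) ≤ (torusOrbit Z g).card := by
        rw [hO]
        refine mul_le_mul_of_nonneg_left ?_ pN.le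
        linarith
      linarith
    · have heq' : ((torusOrbit Z g).card : ℚ) + Nat.card Z = Fintype.card K := by
        exact_mod_cast heq
      rw [hO] at heq'
      have hp := pos g
      have hcK : (centCard g : ℚ) = Fintype.card K := by
        field_simp at heq'
        have : (Nat.card Z : ℚ) * (centCard g - Fintype.card K) = 0 := by linarith
        rcases mul_eq_zero.1 this with h0 | h0 <;> linarith
      have hcK' : centCard g = Fintype.card K := by exact_mod_cast hcK
      refine ⟨g, hg, fun x => ?_, by rw [← hcK']; exact hτ⟩
      have := (Finset.card_eq_iff_eq_univ _).1 hcK'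
      have hx := mem_univ x
      rw [← this] at hx
      exact (mem_filter.1 hx).2
  · exfalso
    push Not at hnr
    obtain ⟨g₀, hg₀⟩ := hne
    have hZ2 : Nat.card Z = 2 := hreal g₀ hg₀ (hnr g₀ hg₀)
    have hO : ∀ g ∉ Z, ((torusOrbit Z g).card : ℚ) =
        Fintype.card K * (1 / 2 - 1 / centCard g) := by
      intro g hg
      rw [h.card_torusOrbit_of_real hg (hnr g hg), hZ2]
      have := pos g
      push_cast
      field_simp
    have hN : ∀ g ∉ Z, 2 ≤ (Fintype.card K : ℚ) * (1 / centCard g) := by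
      intro g hg
      have h1 : (2 : ℚ) * centCard g ≤ Fintype.card K := by
        exact_mod_cast h.two_mul_centCard_le hg (hnr g hg)
      have := pos g
      rw [mul_one_div, le_div_iff₀ this]
      exact h1
    have key : ∀ g ∉ Z, ∃ g₂ g₃, g₂ ∉ Z ∧ g₃ ∉ Z ∧ g₂ ∉ torusOrbit Z g ∧
        g₃ ∉ torusOrbit Z g ∧ g₃ ∉ torusOrbit Z g₂ ∧
        (1 / 2 : ℚ) < 1 / centCard g + 1 / centCard g₂ + 1 / centCard g₃ := by
      intro g hg
      obtain ⟨g₂, hg₂, hn₂⟩ := exists_notMem_of_card_lt (Z := Z) (s := torusOrbit Z g) (by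
        have : ((torusOrbit Z g).card : ℚ) + Nat.card Z < Fintype.card K := by
          rw [hO g hg, hZ2]
          have := hN g hg
          have h1 : (4 : ℚ) ≤ centCard g := by
            have := h.two_mul_card_le_centCard hg
            rw [hZ2] at this
            exact_mod_cast this
          have h2 : (2 : ℚ) * centCard g ≤ Fintype.card K := by
            exact_mod_cast h.two_mul_centCard_le hg (hnr g hg)
          have h3 : (1 : ℚ) / centCard g ≤ 1 / 4 := by
            rw [div_le_div_iff₀ (pos g) (by norm_num)]; linarith
          have h4 := mul_pos pN (one_div_pos.2 (pos g))
          push_cast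
          linarith
        exact_mod_cast this)
      have hd₂ := h.disjoint_torusOrbit hg₂ hn₂
      obtain ⟨g₃, hg₃, hn₃⟩ := exists_notMem_of_card_lt (Z := Z)
        (s := torusOrbit Z g ∪ torusOrbit Z g₂) (by
        have : ((torusOrbit Z g ∪ torusOrbit Z g₂).card : ℚ) + Nat.card Z < Fintype.card K := by
          rw [card_union_of_disjoint hd₂]
          push_cast
          rw [hO g hg, hO g₂ hg₂, hZ2]
          have := hN g hg
          have := hN g₂ hg₂
          push_cast
          linarith
        exact_mod_cast this)
      rw [mem_union, not_or] at hn₃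
      have hd₃ : Disjoint (torusOrbit Z g ∪ torusOrbit Z g₂) (torusOrbit Z g₃) :=
        disjoint_union_left.2 ⟨h.disjoint_torusOrbit hg₃ hn₃.1, h.disjoint_torusOrbit hg₃ hn₃.2⟩
      refine ⟨g₂, g₃, hg₂, hg₃, hn₂, hn₃.1, hn₃.2, ?_⟩
      have hle := card_add_le (Z := Z)
        (s := (torusOrbit Z g ∪ torusOrbit Z g₂) ∪ torusOrbit Z g₃) fun x hx => by
          rcases mem_union.1 hx with hx | hx
          · rcases mem_union.1 hx with hx | hx <;> exact h.torusOrbit_notMem hx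
          · exact h.torusOrbit_notMem hx
      rw [card_union_of_disjoint hd₃, card_union_of_disjoint hd₂, hZ2] at hle
      have hle' : ((torusOrbit Z g).card : ℚ) + (torusOrbit Z g₂).card + (torusOrbit Z g₃).card + 2
        ≤ Fintype.card K := by exact_mod_cast hle
      rw [hO g hg, hO g₂ hg₂, hO g₃ hg₃] at hle'
      refine lt_of_mul_lt_mul_left ?_ pN.le
      linarith
    have heven : ∀ g ∉ Z, 2 ∣ centCard g ∧ 4 ≤ centCard g ∧ m ≤ 4 * centCard g := by
      intro g hg
      have h1 := h.card_dvd_centCard g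
      have h2 := h.two_mul_card_le_centCard hg
      rw [hZ2] at h1 h2
      exact ⟨h1, h2, le_four_mul_centCard hconj (hI g hg)⟩
    have hinvle : ∀ (g : K) (n : ℕ), 0 < n → n ≤ centCard g → (1 : ℚ) / centCard g ≤ 1 / n := by
      intro g n hn hle
      have : (0 : ℚ) < n := by exact_mod_cast hn
      exact one_div_le_one_div_of_le this (by exact_mod_cast hle)
    by_cases h6 : ∀ g ∉ Z, 6 ≤ centCard g
    · obtain ⟨g₂, g₃, hg₂, hg₃, -, -, -, hlt⟩ := key g₀ hg₀
      have a := hinvle g₀ 6 (by norm_num) (h6 _ hg₀)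
      have b := hinvle g₂ 6 (by norm_num) (h6 _ hg₂)
      have c := hinvle g₃ 6 (by norm_num) (h6 _ hg₃)
      push_cast at a b c
      linarith
    · push Not at h6
      obtain ⟨g, hg, hlt6⟩ := h6
      obtain ⟨e1, e2, e3⟩ := heven g hg
      have hτ : centCard g = 4 := by omega
      have hm16 : m = 16 := by omega
      obtain ⟨x, hxc, hxZ, hx2⟩ := exists_sq_mem_of_four_dvd hZ2 (g := g) (by rw [hτ])
      have hcase : ∀ g' ∉ Z, g' ∉ torusOrbit Z g → centCard g' = 6 ∨ 14 ≤ centCard g' := by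
        intro g' hg' hn
        obtain ⟨f1, f2, f3⟩ := heven g' hg'
        have hn4 : ¬ 4 ∣ centCard g' := by
          intro h4
          obtain ⟨x', hxc', hxZ', hx2'⟩ := exists_sq_mem_of_four_dvd hZ2 h4
          have := two_orbit_bound h hconj hg hg' hn hxc hxZ hxc' hxZ'
            ((ht₀ x' hxZ' hx2').trans (ht₀ x hxZ hx2).symm) (hI x hxZ)
          rw [hτ, hm16] at this
          have := one_div_pos.2 (pos g')
          push_cast at *
          linarith
        have hn5 : ¬ 5 ∣ centCard g' := fun hd => h5 hm16 (hd.trans (centCard_dvd g'))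
        omega
      obtain ⟨g₂, g₃, hg₂, hg₃, hn₂, hn₃, hn₂₃, hlt⟩ := key g hg
      rw [hτ] at hlt
      have six : ∀ a : K, centCard a = 6 ∨ 14 ≤ centCard a → (1 : ℚ) / centCard a ≤ 1 / 6 := by
        intro a ha
        exact_mod_cast hinvle a 6 (by norm_num) (by omega)
      rcases hcase g₂ hg₂ hn₂ with c2 | c2
      · rcases hcase g₃ hg₃ hn₃ with c3 | c3
        · obtain ⟨y, hyc, hyZ, hy3⟩ := exists_pow_three_of_three_dvd hZ2 (g := g₂)
            (by rw [c2]; norm_num)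
          obtain ⟨y', hyc', hyZ', hy3'⟩ := exists_pow_three_of_three_dvd hZ2 (g := g₃)
            (by rw [c3]; norm_num)
          have := two_orbit_bound h hconj hg₂ hg₃ hn₂₃ hyc hyZ hyc' hyZ'
            ((ht₁ y' hyZ' hy3').trans (ht₁ y hyZ hy3).symm) (hI y hyZ)
          rw [c2, c3, hm16] at this
          norm_num at this
        · have b := six g₂ (Or.inl c2)
          have c := hinvle g₃ 14 (by norm_num) c3
          push_cast at *
          linarith
      · have b := hinvle g₂ 14 (by norm_num) c2
        have c := six g₃ (hcase g₃ hg₃ hn₃)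
        push_cast at *
        linarith

end IsTorusPartition

end ClassCounting
section SL2Algebra

open Matrix Matrix.SpecialLinearGroup MatrixGroups

variable {F : Type*} [Field F]

namespace SL2

lemma det_eq (g : SL(2, F)) : g 0 0 * g 1 1 - g 0 1 * g 1 0 = 1 := by
  have := g.det_coe
  rwa [Matrix.det_fin_two] at this

lemma ext_entries {g h : SL(2, F)} (h₁ : g 0 0 = h 0 0) (h₂ : g 0 1 = h 0 1)
    (h₃ : g 1 0 = h 1 0) (h₄ : g 1 1 = h 1 1) : g = h := by
  ext i j
  fin_cases i <;> fin_cases j <;> assumption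

lemma mul_entry (g h : SL(2, F)) (i j : Fin 2) :
    (g * h) i j = g i 0 * h 0 j + g i 1 * h 1 j := by
  simp [Matrix.mul_apply, Fin.sum_univ_two]

lemma inv_entries (g : SL(2, F)) :
    g⁻¹ 0 0 = g 1 1 ∧ g⁻¹ 0 1 = -g 0 1 ∧ g⁻¹ 1 0 = -g 1 0 ∧ g⁻¹ 1 1 = g 0 0 := by
  rw [SL2_inv_expl]
  simp

/-- The trace of an element of `SL₂`. -/
def tr (g : SL(2, F)) : F := g 0 0 + g 1 1

lemma tr_mul_comm (g h : SL(2, F)) : tr (g * h) = tr (h * g) := by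
  simp only [tr, mul_entry]; ring

lemma tr_conj (k g : SL(2, F)) : tr (k * g * k⁻¹) = tr g := by
  rw [tr_mul_comm, inv_mul_cancel_left]

lemma tr_inv (g : SL(2, F)) : tr g⁻¹ = tr g := by
  obtain ⟨h1, -, -, h4⟩ := inv_entries g
  rw [tr, h1, h4, tr, add_comm]

lemma mem_center_iff_entries {g : SL(2, F)} :
    g ∈ Subgroup.center SL(2, F) ↔ g 0 1 = 0 ∧ g 1 0 = 0 ∧ g 0 0 = g 1 1 := by
  rw [Matrix.SpecialLinearGroup.mem_center_iff]
  constructor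
  · rintro ⟨r, -, hr⟩
    rw [← hr]
    simp
  · rintro ⟨h1, h2, h3⟩
    refine ⟨g 0 0, ?_, ?_⟩
    · have := det_eq g
      rw [h1, ← h3] at this
      simp only [Fintype.card_fin]
      linear_combination this
    · ext i j
      fin_cases i <;> fin_cases j <;> simp [h1, h2, h3]

lemma mem_center_iff_eq {g : SL(2, F)} :
    g ∈ Subgroup.center SL(2, F) ↔ g = 1 ∨ g = -1 := by
  rw [mem_center_iff_entries]
  constructor
  · rintro ⟨h1, h2, h3⟩
    have := det_eq g
    rw [h1, ← h3] at this
    have h : (g 0 0 - 1) * (g 0 0 + 1) = 0 := by linear_combination this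
    rcases mul_eq_zero.1 h with h | h
    · left
      apply ext_entries <;> simp [h1, h2, ← h3] <;> linear_combination h
    · right
      apply ext_entries <;> simp [h1, h2, ← h3] <;> linear_combination h
  · rintro (rfl | rfl) <;> simp

lemma commute_iff {x g : SL(2, F)} : Commute x g ↔
    x 0 1 * g 1 0 = g 0 1 * x 1 0 ∧ x 0 1 * (g 0 0 - g 1 1) = g 0 1 * (x 0 0 - x 1 1) ∧
      x 1 0 * (g 0 0 - g 1 1) = g 1 0 * (x 0 0 - x 1 1) := by
  constructor
  · intro h
    have h : x * g = g * x := h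
    have e := fun i j => congrArg (fun m : SL(2, F) => m i j) h
    simp only [mul_entry] at e
    refine ⟨?_, ?_, ?_⟩
    · linear_combination e 0 0
    · linear_combination -e 0 1
    · linear_combination e 1 0
  · rintro ⟨h1, h2, h3⟩
    show x * g = g * x
    apply ext_entries <;> simp only [mul_entry]
    · linear_combination h1
    · linear_combination -h2
    · linear_combination h3
    · linear_combination -h1

lemma exists_of_commute {x g : SL(2, F)} (hg : g ∉ Subgroup.center SL(2, F)) (h : Commute x g) :
    ∃ a b : F, x 0 0 = a + b * g 0 0 ∧ x 0 1 = b * g 0 1 ∧ x 1 0 = b * g 1 0 ∧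
      x 1 1 = a + b * g 1 1 := by
  rw [mem_center_iff_entries] at hg
  obtain ⟨h1, h2, h3⟩ := commute_iff.1 h
  by_cases h01 : g 0 1 = 0
  · by_cases h10 : g 1 0 = 0
    · have hd : g 0 0 - g 1 1 ≠ 0 := fun h0 => hg ⟨h01, h10, sub_eq_zero.1 h0⟩
      rw [h01, zero_mul] at h2
      rw [h10, zero_mul] at h3
      have x01 := (mul_eq_zero.1 h2).resolve_right hd
      have x10 := (mul_eq_zero.1 h3).resolve_right hd
      refine ⟨x 0 0 - (x 0 0 - x 1 1) / (g 0 0 - g 1 1) * g 0 0,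
        (x 0 0 - x 1 1) / (g 0 0 - g 1 1), by ring, by simp [x01, h01], by simp [x10, h10], ?_⟩
      field_simp
      ring
    · refine ⟨x 0 0 - x 1 0 / g 1 0 * g 0 0, x 1 0 / g 1 0, by ring, ?_, ?_, ?_⟩
      · field_simp; linear_combination h1
      · field_simp
      · field_simp; linear_combination h3
  · refine ⟨x 0 0 - x 0 1 / g 0 1 * g 0 0, x 0 1 / g 0 1, by ring, ?_, ?_, ?_⟩
    · field_simp
    · field_simp; linear_combination -h1
    · field_simp; linear_combination h2

lemma commute_trans {g x y : SL(2, F)} (hg : g ∉ Subgroup.center SL(2, F)) (hx : Commute x g)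
    (hy : Commute y g) : Commute x y := by
  obtain ⟨a, b, h1, h2, h3, h4⟩ := exists_of_commute hg hx
  obtain ⟨c, d, k1, k2, k3, k4⟩ := exists_of_commute hg hy
  rw [commute_iff, h1, h2, h3, h4, k1, k2, k3, k4]
  refine ⟨?_, ?_, ?_⟩ <;> ring

lemma eq_or_eq_inv_of_commute {g x : SL(2, F)} (hg : g ∉ Subgroup.center SL(2, F))
    (ht : tr g ^ 2 ≠ 4) (hc : Commute x g) (htr : tr x = tr g) : x = g ∨ x = g⁻¹ := by
  obtain ⟨a, b, h1, h2, h3, h4⟩ := exists_of_commute hg hc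
  obtain ⟨i1, i2, i3, i4⟩ := inv_entries g
  have dg := det_eq g
  have dx := det_eq x
  have e1 : 2 * a + b * tr g = tr g := by
    have := htr
    simp only [tr, h1, h4] at this ⊢
    linear_combination this
  have e2 : a ^ 2 + a * b * tr g + b ^ 2 = 1 := by
    rw [h1, h2, h3, h4] at dx
    rw [tr]; linear_combination dx - b ^ 2 * dg
  have hb : (b - 1) * (b + 1) = 0 := by
    have : (tr g ^ 2 - 4) * ((b - 1) * (b + 1)) = 0 := by
      linear_combination ((2 * a + b * tr g) + tr g) * e1 - 4 * e2
    exact (mul_eq_zero.1 this).resolve_left (sub_ne_zero.2 ht)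
  have hzero : 2 * tr g = 0 → tr g ≠ 0 → (2 : F) = 0 := fun h h' =>
    (mul_eq_zero.1 h).resolve_right h'
  have xg : a = 0 → b = 1 → x = g := by
    rintro rfl rfl
    apply ext_entries <;> simp [h1, h2, h3, h4]
  have xi : a = tr g → b = -1 → x = g⁻¹ := by
    rintro rfl rfl
    apply ext_entries <;> simp [h1, h2, h3, h4, i1, i2, i3, i4, tr]
  rcases mul_eq_zero.1 hb with hb | hb
  · have hb : b = 1 := by linear_combination hb
    rw [hb] at e1 e2
    have : a * (a + tr g) = 0 := by linear_combination e2
    rcases mul_eq_zero.1 this with ha | ha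
    · exact Or.inl (xg ha hb)
    · by_cases ht0 : tr g = 0
      · exact Or.inl (xg (by linear_combination ha - ht0) hb)
      · have h20 : (2 : F) = 0 := hzero (by linear_combination 2 * ha - e1) ht0
        exact Or.inr (xi (by linear_combination ha - tr g * h20)
          (by linear_combination hb + h20))
  · have hb : b = -1 := by linear_combination hb
    rw [hb] at e1 e2
    have : a * (a - tr g) = 0 := by linear_combination e2
    rcases mul_eq_zero.1 this with ha | ha
    · by_cases ht0 : tr g = 0
      · exact Or.inr (xi (by linear_combination ha - ht0) hb)
      · have h20 : (2 : F) = 0 := hzero (by linear_combination 2 * ha - e1) ht0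
        exact Or.inl (xg ha (by linear_combination hb - h20))
    · exact Or.inr (xi (by linear_combination ha) hb)

lemma tr_eq_zero_of_sq_mem {x : SL(2, F)} (hx : x ∉ Subgroup.center SL(2, F))
    (h2 : x ^ 2 ∈ Subgroup.center SL(2, F)) : tr x = 0 := by
  rw [mem_center_iff_entries] at hx h2
  simp only [pow_two, mul_entry] at h2
  obtain ⟨h1, h2, h3⟩ := h2
  by_contra ht
  refine hx ⟨?_, ?_, ?_⟩
  · refine (mul_eq_zero.1 ?_).resolve_right ht
    rw [tr]; linear_combination h1
  · refine (mul_eq_zero.1 ?_).resolve_right ht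
    rw [tr]; linear_combination h2
  · refine sub_eq_zero.1 ((mul_eq_zero.1 ?_).resolve_right ht)
    rw [tr]; linear_combination h3

lemma tr_eq_neg_one_of_pow_three {x : SL(2, F)} (hx : x ∉ Subgroup.center SL(2, F))
    (h3 : x ^ 3 = 1) : tr x = -1 := by
  have e := fun i j => congrArg (fun m : SL(2, F) => m i j) h3
  simp only [pow_succ, pow_zero, one_mul, mul_entry] at e
  have e00 := e 0 0
  have e01 := e 0 1
  have e10 := e 1 0
  have e11 := e 1 1
  simp only [coe_one, one_apply_eq, ne_eq, zero_ne_one, one_ne_zero, not_false_eq_true,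
    one_apply_ne] at e00 e01 e10 e11
  have d := det_eq x
  rw [mem_center_iff_entries] at hx
  have ht : tr x ^ 2 - 1 = 0 := by
    by_contra ht
    refine hx ⟨?_, ?_, ?_⟩
    · refine (mul_eq_zero.1 ?_).resolve_right ht
      rw [tr]; linear_combination e01 + x 0 1 * d
    · refine (mul_eq_zero.1 ?_).resolve_right ht
      rw [tr]; linear_combination e10 + x 1 0 * d
    · refine sub_eq_zero.1 ((mul_eq_zero.1 ?_).resolve_right ht)
      rw [tr]; linear_combination e00 - e11 + (x 0 0 - x 1 1) * d
  have : x 0 0 * (tr x ^ 2 - 1) - tr x = 1 := by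
    rw [tr]; linear_combination e00 + (2 * x 0 0 + x 1 1) * d
  rw [ht] at this
  linear_combination -this

lemma inv_ne_self {g : SL(2, F)} (hg : g ∉ Subgroup.center SL(2, F)) (ht : tr g ^ 2 ≠ 4) :
    g⁻¹ ≠ g := by
  intro h
  obtain ⟨i1, i2, i3, i4⟩ := inv_entries g
  rw [h] at i1 i2 i3 i4
  by_cases h2 : (2 : F) = 0
  · apply ht
    rw [tr, i1]
    linear_combination (2 * g 1 1 ^ 2 - 2) * h2
  · refine hg (mem_center_iff_entries.2 ⟨?_, ?_, i1⟩)
    · refine (mul_eq_zero.1 ?_).resolve_left h2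
      linear_combination i2
    · refine (mul_eq_zero.1 ?_).resolve_left h2
      linear_combination i3

lemma tr_eq_zero_of_conj_eq_inv {g k : SL(2, F)} (hg : g ∉ Subgroup.center SL(2, F))
    (ht : tr g ^ 2 ≠ 4) (h : k * g * k⁻¹ = g⁻¹) :
    k ∉ Subgroup.center SL(2, F) ∧ tr k = 0 := by
  have hkg : ¬ Commute k g := by
    intro hc
    apply inv_ne_self hg ht
    rw [← h, hc.eq, mul_inv_cancel_right]
  have hk : k ∉ Subgroup.center SL(2, F) := fun hk =>
    hkg (Subgroup.mem_center_iff.1 hk g).symm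
  refine ⟨hk, tr_eq_zero_of_sq_mem hk ?_⟩
  by_contra hk2
  have e1 : k * g⁻¹ * k⁻¹ = g := by
    have := congrArg (·⁻¹) h
    simp only [_root_.mul_inv_rev, inv_inv] at this
    rw [← mul_assoc] at this
    exact this
  have hc : Commute g (k ^ 2) := by
    have : k ^ 2 * g = g * k ^ 2 := by
      calc k ^ 2 * g = k * (k * g * k⁻¹) * k⁻¹ * k ^ 2 := by simp [mul_assoc, pow_two]
        _ = g * k ^ 2 := by rw [h, e1]
    exact this.symm
  exact hkg (commute_trans hk2 (Commute.pow_right (Commute.refl k) 2) hc)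

lemma natCard_center_le : Nat.card (Subgroup.center SL(2, F)) ≤ 2 := by
  have : (Subgroup.center SL(2, F) : Set SL(2, F)) = {1, -1} := by
    ext g; simpa using mem_center_iff_eq
  rw [← SetLike.coe_sort_coe, this, Nat.card_coe_set_eq]
  exact (Set.ncard_insert_le _ _).trans (by simp)

lemma natCard_center (h2 : (2 : F) ≠ 0) : Nat.card (Subgroup.center SL(2, F)) = 2 := by
  have : (Subgroup.center SL(2, F) : Set SL(2, F)) = {1, -1} := by
    ext g; simpa using mem_center_iff_eq
  rw [← SetLike.coe_sort_coe, this, Nat.card_coe_set_eq, Set.ncard_pair]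
  intro h
  have := congrArg (fun m : SL(2, F) => m 0 0) h
  simp at this
  apply h2
  linear_combination this

lemma isTorusPartition (K : Subgroup SL(2, F))
    (hK : ∀ g ∈ K, g ∉ Subgroup.center SL(2, F) → tr g ^ 2 ≠ 4) :
    IsTorusPartition ((Subgroup.center SL(2, F)).subgroupOf K) where
  central z hz x := Subtype.ext (Subgroup.mem_center_iff.1 (Subgroup.mem_subgroupOf.1 hz) x).symm
  trans g x y hg hx hy := by
    have hx' : Commute (x : SL(2, F)) g := congrArg Subtype.val hx
    have hy' : Commute (y : SL(2, F)) g := congrArg Subtype.val hy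
    exact Subtype.ext (commute_trans (fun h => hg (Subgroup.mem_subgroupOf.2 h)) hx' hy').eq
  fuse g k hg hc := by
    have hg' : (g : SL(2, F)) ∉ Subgroup.center SL(2, F) :=
      fun h => hg (Subgroup.mem_subgroupOf.2 h)
    have hc' : Commute ((k : SL(2, F)) * g * (k : SL(2, F))⁻¹) g := congrArg Subtype.val hc
    exact (eq_or_eq_inv_of_commute hg' (hK g g.2 hg') hc' (tr_conj _ _)).imp
      Subtype.ext Subtype.ext
  inv_ne g hg h := by
    have hg' : (g : SL(2, F)) ∉ Subgroup.center SL(2, F) :=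
      fun h => hg (Subgroup.mem_subgroupOf.2 h)
    exact inv_ne_self hg' (hK g g.2 hg') (congrArg Subtype.val h)

variable [Fintype F]

lemma natCard_eq : Nat.card SL(2, F) = Fintype.card F * (Fintype.card F ^ 2 - 1) := by
  classical
  have hker : Nat.card (GeneralLinearGroup.det (n := Fin 2) (R := F)).ker = Nat.card SL(2, F) := by
    refine (Nat.card_congr (Equiv.ofBijective
      (fun g : SL(2, F) => (⟨toGL g, by
        rw [MonoidHom.mem_ker]; ext; simp⟩ :
        (GeneralLinearGroup.det (n := Fin 2) (R := F)).ker)) ⟨?_, ?_⟩)).symm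
    · intro a b hab
      exact toGL_injective (congrArg Subtype.val hab)
    · rintro ⟨g, hg⟩
      refine ⟨⟨g, ?_⟩, ?_⟩
      · rw [MonoidHom.mem_ker] at hg
        simpa using congrArg Units.val hg
      · apply Subtype.ext; ext; rfl
  have hsurj : Function.Surjective (GeneralLinearGroup.det (n := Fin 2) (R := F)) := by
    intro u
    refine ⟨GeneralLinearGroup.mkOfDetNeZero !![(u : F), 0; 0, 1] (by simp), ?_⟩
    ext; simp [GeneralLinearGroup.mkOfDetNeZero]
  have h1 := Subgroup.card_mul_index (GeneralLinearGroup.det (n := Fin 2) (R := F)).ker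
  rw [Subgroup.index_ker, MonoidHom.range_eq_top.2 hsurj, Subgroup.card_top, hker,
    card_GL_field, Nat.card_units, Nat.card_eq_fintype_card (α := F)] at h1
  simp only [Fin.prod_univ_two, Fin.val_zero, Fin.val_one, pow_zero, pow_one] at h1
  have hq : 1 < Fintype.card F := Fintype.one_lt_card
  have e : Fintype.card F ^ 2 - Fintype.card F = Fintype.card F * (Fintype.card F - 1) := by
    rw [Nat.mul_sub, pow_two, mul_one]
  rw [e] at h1
  have hp : 0 < Fintype.card F - 1 := by omega
  apply Nat.eq_of_mul_eq_mul_right hp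
  rw [h1]; ring

open Classical in
lemma card_tr_eq_le (c : F) :
    (Finset.univ.filter fun g : SL(2, F) => tr g = c).card ≤
      Fintype.card F * (Fintype.card F + 1) := by
  have hsplit := Finset.card_filter_add_card_filter_not
    (s := Finset.univ.filter fun g : SL(2, F) => tr g = c) (fun g => g 1 0 = 0)
  have hq : 1 < Fintype.card F := Fintype.one_lt_card
  have h1 : ((Finset.univ.filter fun g : SL(2, F) => tr g = c).filter
      fun g => g 1 0 = 0).card ≤ 2 * Fintype.card F := by
    let P : Polynomial F := Polynomial.X ^ 2 - Polynomial.C c * Polynomial.X + Polynomial.C 1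
    have hPd : P.natDegree = 2 := by simp only [P]; compute_degree!
    have hP0 : P ≠ 0 := by intro h; rw [h] at hPd; simp at hPd
    calc _ ≤ (P.roots.toFinset ×ˢ (Finset.univ : Finset F)).card := by
          refine Finset.card_le_card_of_injOn (fun g => (g 0 0, g 0 1)) ?_ ?_
          · intro g hg
            simp only [Finset.coe_filter, Finset.mem_filter, Finset.mem_univ, true_and,
              Set.mem_ofPred_eq] at hg
            simp only [Finset.coe_product, Set.mem_prod, Finset.mem_coe, Multiset.mem_toFinset,
              Finset.mem_univ, and_true, Polynomial.mem_roots hP0, Polynomial.IsRoot]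
            simp only [P, Polynomial.eval_add, Polynomial.eval_sub, Polynomial.eval_pow,
              Polynomial.eval_mul, Polynomial.eval_X, Polynomial.eval_C]
            have d := det_eq g
            rw [← hg.1, tr]
            linear_combination -d - g 0 1 * hg.2
          · intro g hg g' hg' h
            simp only [Finset.coe_filter, Finset.mem_filter, Finset.mem_univ, true_and,
              Set.mem_ofPred_eq] at hg hg'
            obtain ⟨h1, h2⟩ := Prod.ext_iff.1 h
            simp only at h1 h2
            refine ext_entries h1 h2 (hg.2.trans hg'.2.symm) ?_
            have := hg.1.trans hg'.1.symm
            rw [tr, tr] at this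
            linear_combination this - h1
      _ ≤ 2 * Fintype.card F := by
          rw [Finset.card_product, Finset.card_univ]
          gcongr
          exact (Multiset.toFinset_card_le _).trans ((Polynomial.card_roots' P).trans hPd.le)
  have h2 : ((Finset.univ.filter fun g : SL(2, F) => tr g = c).filter
      fun g => ¬ g 1 0 = 0).card ≤ Fintype.card F * (Fintype.card F - 1) := by
    calc _ ≤ ((Finset.univ : Finset F) ×ˢ (Finset.univ.erase (0 : F))).card := by
          refine Finset.card_le_card_of_injOn (fun g => (g 0 0, g 1 0)) ?_ ?_
          · intro g hg
            simp only [Finset.coe_filter, Finset.mem_filter, Finset.mem_univ, true_and,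
              Set.mem_ofPred_eq] at hg
            simp [hg.2]
          · intro g hg g' hg' h
            simp only [Finset.coe_filter, Finset.mem_filter, Finset.mem_univ, true_and,
              Set.mem_ofPred_eq] at hg hg'
            obtain ⟨h1, h2⟩ := Prod.ext_iff.1 h
            simp only at h1 h2
            have h4 : g 1 1 = g' 1 1 := by
              have := hg.1.trans hg'.1.symm
              rw [tr, tr] at this
              linear_combination this - h1
            refine ext_entries h1 ?_ h2 h4
            have d := det_eq g
            have d' := det_eq g'
            rw [← h1, ← h2, ← h4] at d'
            have : g 1 0 * (g 0 1 - g' 0 1) = 0 := by linear_combination d' - d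
            exact sub_eq_zero.1 ((mul_eq_zero.1 this).resolve_left hg.2)
      _ = _ := by
          rw [Finset.card_product, Finset.card_erase_of_mem (Finset.mem_univ _), Finset.card_univ]
  have e : Fintype.card F * (Fintype.card F + 1) =
      2 * Fintype.card F + Fintype.card F * (Fintype.card F - 1) := by
    obtain ⟨n, hn⟩ := Nat.exists_eq_add_of_lt hq
    rw [hn, show 1 + n + 1 - 1 = 1 + n by omega]
    ring
  omega

end SL2

end SL2Algebra
section SL2Centralizer

open Matrix Matrix.SpecialLinearGroup MatrixGroups

variable {F : Type*} [Field F]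

namespace SL2

lemma coeff_unique {g : SL(2, F)} (hg : g ∉ Subgroup.center SL(2, F)) {a b a' b' : F}
    (h1 : a + b * g 0 0 = a' + b' * g 0 0) (h2 : b * g 0 1 = b' * g 0 1)
    (h3 : b * g 1 0 = b' * g 1 0) (h4 : a + b * g 1 1 = a' + b' * g 1 1) : a = a' ∧ b = b' := by
  have hb : b = b' := by
    by_contra hne
    refine hg (mem_center_iff_entries.2 ⟨?_, ?_, ?_⟩)
    · exact (mul_eq_zero.1 (by linear_combination h2)).resolve_left (sub_ne_zero.2 hne)
    · exact (mul_eq_zero.1 (by linear_combination h3)).resolve_left (sub_ne_zero.2 hne)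
    · exact sub_eq_zero.1 ((mul_eq_zero.1 (by linear_combination h1 - h4)).resolve_left
        (sub_ne_zero.2 hne))
  subst hb
  exact ⟨by linear_combination h1, rfl⟩

variable [Fintype F]

/-- A group of matrices commuting with a fixed non-central semisimple matrix is cyclic, of order
dividing `q - 1` or `q + 1`. -/
theorem isCyclic_of_forall_commute {g : SL(2, F)} (hg : g ∉ Subgroup.center SL(2, F))
    (ht : tr g ^ 2 ≠ 4) (K : Subgroup SL(2, F)) (hK : ∀ x ∈ K, Commute x g) :
    IsCyclic K ∧ (Nat.card K ∣ Fintype.card F - 1 ∨ Nat.card K ∣ Fintype.card F + 1) := by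
  classical
  let L := AlgebraicClosure F
  let ι : F →+* L := algebraMap F L
  have ι_inj : Function.Injective ι := ι.injective
  obtain ⟨l, hl⟩ : ∃ l : L, l ^ 2 - ι (tr g) * l + 1 = 0 := by
    let P : Polynomial L := Polynomial.X ^ 2 - Polynomial.C (ι (tr g)) * Polynomial.X +
      Polynomial.C 1
    have hPd : P.natDegree = 2 := by simp only [P]; compute_degree!
    have hPd' : P.degree ≠ 0 := by
      intro h
      rw [Polynomial.natDegree_eq_zero_iff_degree_le_zero.2 h.le] at hPd
      exact two_ne_zero hPd.symm
    obtain ⟨l, hl⟩ := IsAlgClosed.exists_root P hPd'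
    refine ⟨l, ?_⟩
    simpa [P, Polynomial.IsRoot] using hl
  have hl' : l ≠ ι (tr g) - l := by
    intro h
    apply ht
    apply ι_inj
    rw [map_pow, map_ofNat]
    linear_combination (2 * l - ι (tr g)) * h - 4 * hl
  choose a b h1 h2 h3 h4 using fun x : K => exists_of_commute hg (hK x x.2)
  have dg := det_eq g
  have hnorm : ∀ x, a x ^ 2 + a x * b x * tr g + b x ^ 2 = 1 := by
    intro x
    have dx := det_eq (x : SL(2, F))
    rw [h1, h2, h3, h4] at dx
    rw [tr]; linear_combination dx - b x ^ 2 * dg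
  have hone : a 1 = 1 ∧ b 1 = 0 := by
    apply coeff_unique hg
    · rw [← h1]; simp
    · rw [← h2]; simp
    · rw [← h3]; simp
    · rw [← h4]; simp
  have hmul : ∀ x y, a (x * y) = a x * a y - b x * b y ∧
      b (x * y) = a x * b y + a y * b x + b x * b y * tr g := by
    intro x y
    apply coeff_unique hg
    · rw [← h1, Subgroup.coe_mul, mul_entry, h1, h2, h1, h3, tr]
      linear_combination b x * b y * -dg
    · rw [← h2, Subgroup.coe_mul, mul_entry, h1, h2, h2, h4, tr]
      ring
    · rw [← h3, Subgroup.coe_mul, mul_entry, h3, h1, h3, h4, tr]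
      ring
    · rw [← h4, Subgroup.coe_mul, mul_entry, h3, h2, h4, h4, tr]
      linear_combination b x * b y * -dg
  let φ : K →* L :=
    { toFun := fun x => ι (a x) + ι (b x) * l
      map_one' := by simp [hone.1, hone.2]
      map_mul' := by
        intro x y
        rw [(hmul x y).1, (hmul x y).2]
        simp only [map_add, map_sub, map_mul]
        linear_combination -ι (b x) * ι (b y) * hl }
  have hφ : ∀ x, φ x = ι (a x) + ι (b x) * l := fun x => rfl
  have hφ' : ∀ x, φ x * (ι (a x) + ι (b x) * (ι (tr g) - l)) = 1 := by
    intro x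
    have := congrArg ι (hnorm x)
    simp only [map_add, map_mul, map_pow, map_one] at this
    rw [hφ]
    linear_combination this - ι (b x) ^ 2 * hl
  have φ_inj : Function.Injective φ := by
    rw [injective_iff_map_eq_one]
    intro x hx
    have e1 := hφ' x
    rw [hx, one_mul] at e1
    rw [hφ] at hx
    have hb : ι (b x) * (l - (ι (tr g) - l)) = 0 := by linear_combination hx - e1
    have hb0 : b x = 0 := ι_inj (by
      rw [map_zero]; exact (mul_eq_zero.1 hb).resolve_right (sub_ne_zero.2 hl'))
    have ha : a x = 1 := ι_inj (by rw [hb0] at hx; simpa using hx)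
    apply Subtype.ext
    apply ext_entries
    · rw [h1, ha, hb0]; simp
    · rw [h2, hb0]; simp
    · rw [h3, hb0]; simp
    · rw [h4, ha, hb0]; simp
  have hcyc : IsCyclic K := isCyclic_of_injective_ringHom φ φ_inj
  have hcard : ∀ n, (∀ x, φ x ^ n = 1) → Nat.card K ∣ n := by
    intro n hn
    rw [← IsCyclic.exponent_eq_card]
    apply Monoid.exponent_dvd_of_forall_pow_eq_one
    intro x
    apply φ_inj
    rw [map_pow, hn, map_one]
  refine ⟨hcyc, ?_⟩
  let σ : L →ₐ[F] L := FiniteField.frobeniusAlgHom F L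
  have hσ : ∀ y, σ y = y ^ Fintype.card F := fun y => rfl
  have hσι : ∀ y, σ (ι y) = ι y := fun y => σ.commutes y
  have hφq : ∀ x, φ x ^ Fintype.card F = ι (a x) + ι (b x) * σ l := by
    intro x
    rw [← hσ, hφ, map_add, map_mul, hσι, hσι]
  have hσl : (σ l - l) * (σ l - (ι (tr g) - l)) = 0 := by
    have := congrArg σ hl
    simp only [map_add, map_sub, map_mul, map_pow, map_one, map_zero, hσι] at this
    linear_combination this - hl
  rcases mul_eq_zero.1 hσl with h | h
  · left
    apply hcard
    intro x
    have hx : φ x ≠ 0 := left_ne_zero_of_mul_eq_one (hφ' x)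
    have e := hφq x
    rw [sub_eq_zero.1 h, ← hφ] at e
    apply mul_right_cancel₀ hx
    rw [← pow_succ, Nat.sub_add_cancel Fintype.card_pos, e, one_mul]
  · right
    apply hcard
    intro x
    rw [pow_succ, hφq, sub_eq_zero.1 h, mul_comm]
    exact hφ' x

end SL2

end SL2Centralizer
section FixityFour

open Matrix Matrix.SpecialLinearGroup MatrixGroups MulAction

variable {F : Type*} [Field F]

/-- `SL₂(F)` acts transitively on `Ω`, the center acting trivially, the other elements fixing at
most four points, and some of them exactly four. -/
structure SL2.FixityFour (F Ω : Type*) [Field F] [MulAction SL(2, F) Ω] : Prop where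
  trans : ∀ x y : Ω, ∃ g : SL(2, F), g • x = y
  center_smul : ∀ z ∈ Subgroup.center SL(2, F), ∀ x : Ω, z • x = x
  ncard_le : ∀ g ∉ Subgroup.center SL(2, F), {x : Ω | g • x = x}.ncard ≤ 4
  exists_eq : ∃ g ∉ Subgroup.center SL(2, F), {x : Ω | g • x = x}.ncard = 4

namespace SL2

lemma notMem_center_of_tr {g : SL(2, F)} (h : tr g ^ 2 ≠ 4) : g ∉ Subgroup.center SL(2, F) := by
  intro hg
  apply h
  rcases mem_center_iff_eq.1 hg with rfl | rfl <;> simp [tr] <;> norm_num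

lemma conj_mem_center_iff {g k : SL(2, F)} :
    k * g * k⁻¹ ∈ Subgroup.center SL(2, F) ↔ g ∈ Subgroup.center SL(2, F) := by
  constructor
  · intro h
    have := Subgroup.Normal.conj_mem inferInstance _ h k⁻¹
    simpa [mul_assoc] using this
  · intro h
    exact Subgroup.Normal.conj_mem inferInstance _ h k

namespace FixityFour

variable {Ω : Type*} [MulAction SL(2, F) Ω]

lemma center_le (h : FixityFour F Ω) (α : Ω) :
    Subgroup.center SL(2, F) ≤ stabilizer SL(2, F) α :=
  fun z hz => h.center_smul z hz α

lemma ncard_fixed_conj (g k : SL(2, F)) :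
    {x : Ω | (k * g * k⁻¹) • x = x}.ncard = {x : Ω | g • x = x}.ncard := by
  have : {x : Ω | (k * g * k⁻¹) • x = x} = (fun x => k • x) '' {x : Ω | g • x = x} := by
    ext x
    simp only [Set.mem_ofPred_eq, Set.mem_image]
    constructor
    · intro hx
      refine ⟨k⁻¹ • x, ?_, smul_inv_smul k x⟩
      rw [mul_smul, mul_smul, smul_eq_iff_eq_inv_smul] at hx
      exact hx
    · rintro ⟨y, hy, rfl⟩
      simp [mul_smul, hy]
  rw [this, Set.ncard_image_of_injective _ (MulAction.injective k)]

lemma exists_mem_stabilizer (h : FixityFour F Ω) (α : Ω) :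
    ∃ g ∈ stabilizer SL(2, F) α, g ∉ Subgroup.center SL(2, F) ∧
      {x : Ω | g • x = x}.ncard = 4 := by
  obtain ⟨g, hg, h4⟩ := h.exists_eq
  obtain ⟨β, hβ⟩ : {x : Ω | g • x = x}.Nonempty := by
    rw [Set.nonempty_iff_ne_empty]
    intro h0
    rw [h0, Set.ncard_empty] at h4
    omega
  obtain ⟨k, hk⟩ := h.trans β α
  refine ⟨k * g * k⁻¹, ?_, conj_mem_center_iff.not.2 hg, (ncard_fixed_conj g k).trans h4⟩
  have hβ : g • β = β := hβ
  rw [mem_stabilizer_iff, ← hk]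
  simp [mul_smul, hβ]

lemma card_mul_card (h : FixityFour F Ω) [Finite Ω] (α : Ω) :
    Nat.card Ω * Nat.card (stabilizer SL(2, F) α) = Nat.card SL(2, F) := by
  have : IsPretransitive SL(2, F) Ω := ⟨h.trans⟩
  rw [← index_stabilizer_of_transitive SL(2, F) α, mul_comm, Subgroup.card_mul_index]

variable [Fintype F]

open Classical in
lemma card_tr_stabilizer_eq (h : FixityFour F Ω) (c : F) (α β : Ω) :
    (Finset.univ.filter fun g : SL(2, F) => tr g = c ∧ g • β = β).card =
      (Finset.univ.filter fun g : SL(2, F) => tr g = c ∧ g • α = α).card := by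
  obtain ⟨k, hk⟩ := h.trans β α
  refine Finset.card_bij (fun g _ => k * g * k⁻¹) ?_ ?_ ?_
  · intro g hg
    simp only [Finset.mem_filter, Finset.mem_univ, true_and] at hg ⊢
    refine ⟨(tr_conj _ _).trans hg.1, ?_⟩
    rw [← hk]
    simp [mul_smul, hg.2]
  · intro g _ g' _ hgg
    simpa using hgg
  · intro g hg
    simp only [Finset.mem_filter, Finset.mem_univ, true_and] at hg
    refine ⟨k⁻¹ * g * k, ?_, by simp [mul_assoc]⟩
    simp only [Finset.mem_filter, Finset.mem_univ, true_and]
    constructor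
    · simpa using (tr_conj k⁻¹ g).trans hg.1
    · rw [mul_smul, mul_smul, hk, hg.2, ← hk, inv_smul_smul]

open Classical in
lemma card_tr_stabilizer_le [Finite Ω] (h : FixityFour F Ω) {c : F} (hc : c ^ 2 ≠ 4) (α : Ω) :
    (Fintype.card F - 1) *
      (Finset.univ.filter fun g : SL(2, F) => tr g = c ∧ g • α = α).card ≤
      4 * Nat.card (stabilizer SL(2, F) α) := by
  have := Fintype.ofFinite Ω
  set N := (Finset.univ.filter fun g : SL(2, F) => tr g = c ∧ g • α = α).card with hN
  set q := Fintype.card F with hq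
  have hdc := Finset.sum_card_bipartiteAbove_eq_sum_card_bipartiteBelow
    (s := Finset.univ.filter fun g : SL(2, F) => tr g = c) (t := (Finset.univ : Finset Ω))
    (fun g x => g • x = x)
  have h1 : ∑ x : Ω, ((Finset.univ.filter fun g : SL(2, F) => tr g = c).bipartiteBelow
      (fun g x => g • x = x) x).card = Nat.card Ω * N := by
    rw [Finset.sum_congr rfl fun x _ => ?_, Finset.sum_const, Finset.card_univ,
      Nat.card_eq_fintype_card, smul_eq_mul]
    rw [Finset.bipartiteBelow, Finset.filter_filter]
    exact h.card_tr_stabilizer_eq c α x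
  have h2 : ∑ g ∈ Finset.univ.filter (fun g : SL(2, F) => tr g = c),
      ((Finset.univ : Finset Ω).bipartiteAbove (fun g x => g • x = x) g).card ≤
      (q * (q + 1)) * 4 := by
    refine (Finset.sum_le_card_nsmul _ _ 4 ?_).trans ?_
    · intro g hg
      rw [Finset.mem_filter] at hg
      have hgc : g ∉ Subgroup.center SL(2, F) := notMem_center_of_tr (by rw [hg.2]; exact hc)
      have := h.ncard_le g hgc
      have e : ((Finset.univ : Finset Ω).bipartiteAbove (fun g x => g • x = x) g : Set Ω) =
          {x : Ω | g • x = x} := by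
        ext x; simp
      rwa [← e, Set.ncard_coe_finset] at this
    · rw [smul_eq_mul]
      exact Nat.mul_le_mul_right _ (card_tr_eq_le c)
  rw [hdc, h1] at h2
  have h3 := h.card_mul_card α
  rw [natCard_eq, ← hq] at h3
  have hΩ : 0 < Nat.card Ω := @Nat.card_pos _ ⟨α⟩ _
  have hq1 : 1 ≤ q := Fintype.card_pos
  apply Nat.le_of_mul_le_mul_left _ hΩ
  calc Nat.card Ω * ((q - 1) * N) = (q - 1) * (Nat.card Ω * N) := by ring
    _ ≤ (q - 1) * (q * (q + 1) * 4) := Nat.mul_le_mul_left _ h2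
    _ = 4 * (q * (q ^ 2 - 1)) := by
      rw [show q ^ 2 - 1 = (q - 1) * (q + 1) by
        rw [mul_comm, ← Nat.sq_sub_sq, one_pow]]
      ring
    _ = _ := by rw [← h3]; ring

end FixityFour

end SL2

end FixityFour
section SemisimpleStabilizer

open Matrix Matrix.SpecialLinearGroup MatrixGroups MulAction

variable {F : Type*} [Field F] [Fintype F] {Ω : Type*} [MulAction SL(2, F) Ω]

namespace SL2.FixityFour

open Classical in
lemma card_filter_stabilizer (c : F) (α : Ω) [Fintype (stabilizer SL(2, F) α)] :
    (Finset.univ.filter fun x : stabilizer SL(2, F) α => tr (x : SL(2, F)) = c).card =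
      (Finset.univ.filter fun g : SL(2, F) => tr g = c ∧ g • α = α).card := by
  refine Finset.card_bij (fun x _ => (x : SL(2, F))) ?_ ?_ ?_
  · intro x hx
    simp only [Finset.mem_filter, Finset.mem_univ, true_and] at hx ⊢
    exact ⟨hx, x.2⟩
  · intro x _ y _ hxy
    exact Subtype.ext hxy
  · intro g hg
    simp only [Finset.mem_filter, Finset.mem_univ, true_and] at hg
    exact ⟨⟨g, hg.2⟩, by simpa using hg.1, rfl⟩

/-- If a point stabilizer meets the classes of trace `±2` only in the center, it centralizes a
non-central element. -/
lemma exists_forall_commute [Finite Ω] (h : FixityFour F Ω) (hq : 17 ≤ Fintype.card F) (α : Ω)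
    (hK : ∀ g ∈ stabilizer SL(2, F) α, g ∉ Subgroup.center SL(2, F) → tr g ^ 2 ≠ 4) :
    ∃ g ∈ stabilizer SL(2, F) α, g ∉ Subgroup.center SL(2, F) ∧
      (∀ x ∈ stabilizer SL(2, F) α, Commute x g) ∧
      Fintype.card F - 1 ≤ 2 * Nat.card (stabilizer SL(2, F) α) := by
  classical
  have := Fintype.ofFinite (stabilizer SL(2, F) α)
  set K := stabilizer SL(2, F) α with hKdef
  set Z := (Subgroup.center SL(2, F)).subgroupOf K with hZdef
  have hmem : ∀ g : K, g ∈ Z ↔ (g : SL(2, F)) ∈ Subgroup.center SL(2, F) :=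
    fun g => Subgroup.mem_subgroupOf
  have hZcard : Nat.card Z = Nat.card (Subgroup.center SL(2, F)) :=
    Nat.card_congr (Subgroup.subgroupOfEquivOfLe (h.center_le α)).toEquiv
  obtain ⟨g₀, hg₀, hg₀c, -⟩ := h.exists_mem_stabilizer α
  have key : ∃ g : K, g ∉ Z ∧ (∀ x, Commute x g) ∧
      Fintype.card F - 1 ≤ 2 * Fintype.card K := by
    refine (isTorusPartition K hK).exists_forall_commute
      (tr := fun x : K => tr (x : SL(2, F))) (m := Fintype.card F - 1) (t₀ := 0) (t₁ := -1)
      ⟨⟨g₀, hg₀⟩, fun hz => hg₀c ((hmem _).1 hz)⟩ (by omega)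
      (fun k x => tr_conj _ _) (fun x => tr_inv _) ?_ (hZcard.trans_le natCard_center_le)
      ?_ ?_ ?_ ?_
    · intro g hg
      have := h.card_tr_stabilizer_le (hK g g.2 fun hz => hg ((hmem _).2 hz)) α
      rw [card_filter_stabilizer, ← Nat.card_eq_fintype_card (α := K)]
      exact this
    · rintro g hg ⟨k, hk⟩
      have hk' : (k : SL(2, F)) * g * (k : SL(2, F))⁻¹ = (g : SL(2, F))⁻¹ :=
        congrArg Subtype.val hk
      have hgc : (g : SL(2, F)) ∉ Subgroup.center SL(2, F) := fun hz => hg ((hmem _).2 hz)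
      obtain ⟨hkc, hkt⟩ := tr_eq_zero_of_conj_eq_inv hgc (hK g g.2 hgc) hk'
      rw [hZcard]
      apply natCard_center
      intro h2
      apply hK k k.2 hkc
      rw [hkt]
      linear_combination -2 * h2
    · intro x hx hx2
      exact tr_eq_zero_of_sq_mem (fun hz => hx ((hmem _).2 hz)) ((hmem _).1 hx2)
    · intro x hx hx3
      exact tr_eq_neg_one_of_pow_three (fun hz => hx ((hmem _).2 hz)) (congrArg Subtype.val hx3)
    · intro hm h5
      have hq17 : Fintype.card F = 17 := by omega
      have hd : Fintype.card K ∣ Nat.card SL(2, F) := by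
        rw [← Nat.card_eq_fintype_card]
        exact Subgroup.card_subgroup_dvd_card K
      rw [natCard_eq, hq17] at hd
      have := h5.trans hd
      omega
  obtain ⟨g, hg, hcomm, hle⟩ := key
  refine ⟨g, g.2, fun hz => hg ((hmem _).2 hz), fun x hx => ?_, ?_⟩
  · exact congrArg Subtype.val (hcomm ⟨x, hx⟩)
  · rwa [Nat.card_eq_fintype_card]

/-- If a point stabilizer meets the classes of trace `±2` only in the center, it is cyclic of
order `(q ± 1) / 2`. -/
theorem isCyclic_stabilizer [Finite Ω] (h : FixityFour F Ω) (hq : 17 ≤ Fintype.card F) (α : Ω)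
    (hK : ∀ g ∈ stabilizer SL(2, F) α, g ∉ Subgroup.center SL(2, F) → tr g ^ 2 ≠ 4) :
    IsCyclic (stabilizer SL(2, F) α) ∧
      (2 * Nat.card (stabilizer SL(2, F) α) = Fintype.card F - 1 ∨
        2 * Nat.card (stabilizer SL(2, F) α) = Fintype.card F + 1) := by
  obtain ⟨g, hgK, hgc, hcomm, hle⟩ := h.exists_forall_commute hq α hK
  have hgt := hK g hgK hgc
  obtain ⟨hcyc, hdvd⟩ := isCyclic_of_forall_commute hgc hgt _ hcomm
  refine ⟨hcyc, ?_⟩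
  set K := stabilizer SL(2, F) α with hKdef
  set q := Fintype.card F with hqdef
  by_contra hne
  rw [not_or] at hne
  have hcard : Nat.card K = q - 1 ∨ Nat.card K = q + 1 := by
    rcases hdvd with ⟨n, hn⟩ | ⟨n, hn⟩
    · left
      have hn3 : n < 2 := by
        by_contra hn2
        have h3 : 3 ≤ n := by
          rcases Nat.lt_or_ge n 3 with h' | h'
          · obtain rfl : n = 2 := by omega
            omega
          · exact h'
        have := Nat.mul_le_mul_left (Nat.card K) h3
        omega
      interval_cases n <;> omega
    · right
      have hn3 : n < 2 := by
        by_contra hn2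
        have h3 : 3 ≤ n := by
          rcases Nat.lt_or_ge n 3 with h' | h'
          · obtain rfl : n = 2 := by omega
            omega
          · exact h'
        have := Nat.mul_le_mul_left (Nat.card K) h3
        omega
      interval_cases n <;> omega
  have hcent : ∀ x, Commute x g → x ∈ K := by
    let C := Subgroup.centralizer {g}
    have hCmem : ∀ x ∈ C, Commute x g := fun x hx =>
      (Subgroup.mem_centralizer_singleton_iff.1 hx)
    obtain ⟨-, hC⟩ := isCyclic_of_forall_commute hgc hgt C hCmem
    have hKC : K ≤ C := fun x hx => Subgroup.mem_centralizer_singleton_iff.2 (hcomm x hx)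
    have hCcard : Nat.card C ≤ q + 1 := by
      rcases hC with hC | hC
      · exact (Nat.le_of_dvd (by omega) hC).trans (by omega)
      · exact Nat.le_of_dvd (by omega) hC
    obtain ⟨n, hn⟩ := Subgroup.card_dvd_of_le hKC
    have hCpos : 0 < Nat.card C := Nat.card_pos
    have hn1 : n = 1 := by
      have h2 : n < 2 := by
        by_contra h2
        have := Nat.mul_le_mul_left (Nat.card K) (not_lt.1 h2)
        omega
      interval_cases n <;> omega
    have hKC' : K = C := Subgroup.eq_of_le_of_card_ge hKC (by rw [hn, hn1, mul_one])
    intro x hx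
    rw [hKC']
    exact Subgroup.mem_centralizer_singleton_iff.2 hx
  obtain ⟨k, hkK, hkc, hk4⟩ := h.exists_mem_stabilizer α
  have hkt := hK k hkK hkc
  have hself : ∀ y, Commute y k → y ∈ K := fun y hy =>
    hcent y (commute_trans hkc hy (hcomm k hkK).symm)
  have hinv : ∀ y : SL(2, F), k • (y • α) = y • α → y • α ≠ α → y⁻¹ * k * y = k⁻¹ := by
    intro y hy hyα
    have hyK : y⁻¹ * k * y ∈ K := by
      rw [hKdef, mem_stabilizer_iff, mul_smul, mul_smul, hy, inv_smul_smul]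
    have hc : Commute (y⁻¹ * k * y) k := commute_trans hgc (hcomm _ hyK) (hcomm k hkK)
    have htr : tr (y⁻¹ * k * y) = tr k := by simpa using tr_conj y⁻¹ k
    refine (eq_or_eq_inv_of_commute hkc hkt hc htr).resolve_left fun heq => hyα ?_
    refine hself y ?_
    have : y * (y⁻¹ * k * y) = y * k := by rw [heq]
    rw [← mul_assoc, ← mul_assoc, mul_inv_cancel, one_mul] at this
    exact this.symm
  have huniq : ∀ x₁ x₂ : Ω, k • x₁ = x₁ → x₁ ≠ α → k • x₂ = x₂ → x₂ ≠ α → x₁ = x₂ := by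
    intro x₁ x₂ h1 h1' h2 h2'
    obtain ⟨y₁, rfl⟩ := h.trans α x₁
    obtain ⟨y₂, rfl⟩ := h.trans α x₂
    have e1 := hinv y₁ h1 h1'
    have e2 := hinv y₂ h2 h2'
    have : y₂⁻¹ * y₁ ∈ K := by
      apply hself
      have s₁ : SemiconjBy y₁⁻¹ k k⁻¹ := by
        rw [← e1]; simp [SemiconjBy, mul_assoc]
      have s₂ : SemiconjBy y₂⁻¹ k k⁻¹ := by
        rw [← e2]; simp [SemiconjBy, mul_assoc]
      have s₁' := s₁.inv_symm_left.inv_right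
      have s₂' := s₂.inv_right
      simp only [inv_inv] at s₁' s₂'
      exact s₂'.mul_left s₁'
    rw [hKdef, mem_stabilizer_iff, mul_smul, inv_smul_eq_iff] at this
    exact this
  have hle2 : {x : Ω | k • x = x}.ncard ≤ 2 := by
    by_cases hex : ∃ x, k • x = x ∧ x ≠ α
    · obtain ⟨x₁, h1, h1'⟩ := hex
      have hsub : {x : Ω | k • x = x} ⊆ {α, x₁} := by
        intro x hx
        by_cases hxα : x = α
        · exact Or.inl hxα
        · exact Or.inr (huniq x x₁ hx hxα h1 h1')
      exact (Set.ncard_le_ncard hsub).trans ((Set.ncard_insert_le _ _).trans (by simp))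
    · have hsub : {x : Ω | k • x = x} ⊆ {α} := by
        intro x hx
        by_contra hxα
        exact hex ⟨x, hx, hxα⟩
      exact (Set.ncard_le_ncard hsub).trans (by simp)
  omega

end SL2.FixityFour

end SemisimpleStabilizer
section SL2Borel

open Matrix Matrix.SpecialLinearGroup MatrixGroups MulAction

variable {F : Type*} [Field F]

namespace SL2

/-- The upper unipotent matrices. -/
def unipotent : Multiplicative F →* SL(2, F) where
  toFun s := ⟨!![1, s.toAdd; 0, 1], by simp⟩
  map_one' := by apply ext_entries <;> simp
  map_mul' s t := Subtype.ext <| by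
    change !![1, (s * t).toAdd; 0, 1] = !![1, s.toAdd; 0, 1] * !![1, t.toAdd; 0, 1]
    simp [add_comm]

/-- The diagonal matrices. -/
def diagonal : Fˣ →* SL(2, F) where
  toFun a := ⟨!![(a : F), 0; 0, ((a⁻¹ : Fˣ) : F)], by simp⟩
  map_one' := by apply ext_entries <;> simp
  map_mul' a b := Subtype.ext <| by
    change !![((a * b : Fˣ) : F), 0; 0, (((a * b)⁻¹ : Fˣ) : F)] =
      !![(a : F), 0; 0, ((a⁻¹ : Fˣ) : F)] * !![(b : F), 0; 0, ((b⁻¹ : Fˣ) : F)]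
    simp [mul_comm]

/-- The unipotent matrix with upper right entry `s`. -/
abbrev u (s : F) : SL(2, F) := unipotent (Multiplicative.ofAdd s)

lemma u_entries (s : F) : u s 0 0 = 1 ∧ u s 0 1 = s ∧ u s 1 0 = 0 ∧ u s 1 1 = 1 :=
  ⟨rfl, rfl, rfl, rfl⟩

lemma diagonal_entries (a : Fˣ) : diagonal a 0 0 = (a : F) ∧ diagonal a 0 1 = 0 ∧
    diagonal a 1 0 = 0 ∧ diagonal a 1 1 = (a : F)⁻¹ :=
  ⟨rfl, rfl, rfl, Units.val_inv_eq_inv_val a⟩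

lemma u_add (s t : F) : u (s + t) = u s * u t := by
  rw [u, ofAdd_add, map_mul]

lemma u_zero : u (0 : F) = 1 := by rw [u, ofAdd_zero, map_one]

lemma u_mul_comm (s t : F) : u s * u t = u t * u s := by
  rw [← u_add, add_comm, u_add]

lemma diagonal_mul_u (a : Fˣ) (s : F) : diagonal a * u s = u ((a : F) ^ 2 * s) * diagonal a := by
  obtain ⟨h1, h2, h3, h4⟩ := u_entries s
  obtain ⟨h1', h2', h3', h4'⟩ := u_entries ((a : F) ^ 2 * s)
  obtain ⟨k1, k2, k3, k4⟩ := diagonal_entries a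
  apply ext_entries <;> simp only [mul_entry, h1, h2, h3, h4, h1', h2', h3', h4', k1, k2, k3, k4]
  · ring
  · field_simp
    ring
  · ring
  · ring

lemma diagonal_neg_one : diagonal (-1 : Fˣ) = -1 := by
  obtain ⟨k1, k2, k3, k4⟩ := diagonal_entries (-1 : Fˣ)
  apply ext_entries <;> simp [k1, k2, k3, k4]

lemma u_mem_center {s : F} (h : u s ∈ Subgroup.center SL(2, F)) : s = 0 := by
  rw [mem_center_iff_entries, (u_entries s).2.1] at h
  exact h.1

lemma diagonal_mem_center_iff {a : Fˣ} :
    diagonal a ∈ Subgroup.center SL(2, F) ↔ a = 1 ∨ a = -1 := by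
  obtain ⟨k1, k2, k3, k4⟩ := diagonal_entries a
  rw [mem_center_iff_entries, k1, k2, k3, k4]
  constructor
  · rintro ⟨-, -, h⟩
    have h1 : (a : F) ^ 2 = 1 := by
      rw [pow_two]; nth_rewrite 1 [h]; simp
    rcases sq_eq_one_iff.1 h1 with h | h
    · exact Or.inl (Units.ext h)
    · exact Or.inr (Units.ext h)
  · rintro (rfl | rfl) <;> simp

lemma eq_u_mul_diagonal {g : SL(2, F)} (h : g 1 0 = 0) :
    ∃ (s : F) (a : Fˣ), g = u s * diagonal a ∧ (a : F) = g 0 0 := by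
  have d := det_eq g
  rw [h, mul_zero, sub_zero] at d
  have h0 : g 0 0 ≠ 0 := left_ne_zero_of_mul_eq_one d
  refine ⟨g 0 0 * g 0 1, Units.mk0 _ h0, ?_, rfl⟩
  obtain ⟨h1, h2, h3, h4⟩ := u_entries (g 0 0 * g 0 1)
  obtain ⟨k1, k2, k3, k4⟩ := diagonal_entries (Units.mk0 _ h0)
  apply ext_entries <;> simp only [mul_entry, h1, h2, h3, h4, k1, k2, k3, k4, Units.val_mk0]
  · ring
  · field_simp; ring
  · rw [h]; ring
  · field_simp; linear_combination d

/-- A non-central element of trace `±2` is conjugate to a unipotent matrix up to sign. -/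
lemma exists_conj_eq_u {g : SL(2, F)} (hg : g ∉ Subgroup.center SL(2, F)) (ht : tr g = 2) :
    ∃ (k : SL(2, F)) (t : F), t ≠ 0 ∧ k * g * k⁻¹ = u t := by
  have d := det_eq g
  have ht' : g 1 1 = 2 - g 0 0 := by rw [tr] at ht; linear_combination ht
  rw [ht'] at d
  by_cases hc : g 1 0 = 0
  · have h00 : g 0 0 = 1 := by
      have : (g 0 0 - 1) ^ 2 = 0 := by rw [hc] at d; linear_combination -d
      exact sub_eq_zero.1 (pow_eq_zero_iff two_ne_zero |>.1 this)
    have hgu : g = u (g 0 1) := by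
      obtain ⟨h1, h2, h3, h4⟩ := u_entries (g 0 1)
      apply ext_entries
      · rw [h1, h00]
      · rw [h2]
      · rw [h3, hc]
      · rw [h4, ht', h00]; norm_num
    refine ⟨1, g 0 1, fun h => hg ?_, by simpa using hgu⟩
    rw [hgu, h, u_zero]
    exact Subgroup.one_mem _
  · let k : SL(2, F) := ⟨!![0, (g 1 0)⁻¹; -g 1 0, g 0 0 - 1], by simp [hc]⟩
    have k1 : k 0 0 = 0 := rfl
    have k2 : k 0 1 = (g 1 0)⁻¹ := rfl
    have k3 : k 1 0 = -g 1 0 := rfl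
    have k4 : k 1 1 = g 0 0 - 1 := rfl
    refine ⟨k, -(g 1 0)⁻¹, by simpa using hc, ?_⟩
    rw [mul_inv_eq_iff_eq_mul]
    obtain ⟨h1, h2, h3, h4⟩ := u_entries (-(g 1 0)⁻¹)
    apply ext_entries <;> simp only [mul_entry, h1, h2, h3, h4, k1, k2, k3, k4, ht']
    · field_simp; ring
    · field_simp; ring
    · ring
    · linear_combination d

/-- The upper unipotent matrices together with any matrix that is not upper triangular generate
`SL₂`. -/
lemma eq_top_of_unipotent_le {K : Subgroup SL(2, F)} (hu : ∀ s : F, u s ∈ K) {g : SL(2, F)}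
    (hg : g ∈ K) (hc : g 1 0 ≠ 0) : K = ⊤ := by
  set c := g 1 0 with hcdef
  let w : SL(2, F) := ⟨!![0, -c⁻¹; c, 0], by simp [hc]⟩
  let l : F → SL(2, F) := fun z => ⟨!![1, 0; z, 1], by simp⟩
  have w1 : w 0 0 = 0 := rfl
  have w2 : w 0 1 = -c⁻¹ := rfl
  have w3 : w 1 0 = c := rfl
  have w4 : w 1 1 = 0 := rfl
  have l1 : ∀ z, l z 0 0 = 1 := fun z => rfl
  have l2 : ∀ z, l z 0 1 = 0 := fun z => rfl
  have l3 : ∀ z, l z 1 0 = z := fun z => rfl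
  have l4 : ∀ z, l z 1 1 = 1 := fun z => rfl
  have u1 : ∀ s : F, u s 0 0 = 1 := fun s => (u_entries s).1
  have u2 : ∀ s : F, u s 0 1 = s := fun s => (u_entries s).2.1
  have u3 : ∀ s : F, u s 1 0 = 0 := fun s => (u_entries s).2.2.1
  have u4 : ∀ s : F, u s 1 1 = 1 := fun s => (u_entries s).2.2.2
  have hw : w ∈ K := by
    have hgw : g = u (g 0 0 / c) * w * u (g 1 1 / c) := by
      have d := det_eq g
      rw [← hcdef] at d
      apply ext_entries <;> simp only [mul_entry, w1, w2, w3, w4, u1, u2, u3, u4]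
      · field_simp; ring
      · field_simp; linear_combination -d
      · rw [← hcdef]; ring
      · field_simp; ring
    have : w = (u (g 0 0 / c))⁻¹ * g * (u (g 1 1 / c))⁻¹ := by
      rw [eq_mul_inv_iff_mul_eq, eq_inv_mul_iff_mul_eq, ← mul_assoc]
      exact hgw.symm
    rw [this]
    exact K.mul_mem (K.mul_mem (K.inv_mem (hu _)) hg) (K.inv_mem (hu _))
  have hl : ∀ z, l z ∈ K := by
    intro z
    have : l z = w * u (-z / c ^ 2) * w⁻¹ := by
      rw [eq_mul_inv_iff_mul_eq]
      apply ext_entries <;>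
        simp only [mul_entry, w1, w2, w3, w4, u1, u2, u3, u4, l1, l2, l3, l4]
      · ring
      · ring
      · ring
      · field_simp
    rw [this]
    exact K.mul_mem (K.mul_mem hw (hu _)) (K.inv_mem hw)
  have hlow : ∀ h : SL(2, F), h 1 0 ≠ 0 → h ∈ K := by
    intro h h0
    have : h = u ((h 0 0 - 1) / h 1 0) * l (h 1 0) * u ((h 1 1 - 1) / h 1 0) := by
      have d := det_eq h
      apply ext_entries <;> simp only [mul_entry, u1, u2, u3, u4, l1, l2, l3, l4]
      · field_simp; ring
      · field_simp; linear_combination -d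
      · ring
      · field_simp; ring
    rw [this]
    exact K.mul_mem (K.mul_mem (hu _) (hl _)) (hu _)
  rw [eq_top_iff]
  intro h _
  by_cases h0 : h 1 0 = 0
  · have d := det_eq h
    rw [h0, mul_zero, sub_zero] at d
    have h1 : (h * l 1) 1 0 ≠ 0 := by
      rw [mul_entry, h0, l3, l1]
      simpa using right_ne_zero_of_mul_eq_one d
    have := K.mul_mem (hlow _ h1) (K.inv_mem (hl 1))
    rwa [mul_inv_cancel_right] at this
  · exact hlow h h0

end SL2

end SL2Borel
section UnipotentFixedPoints

open Matrix Matrix.SpecialLinearGroup MatrixGroups MulAction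

lemma FiniteField.exists_sq_add_sq_eq {F : Type*} [Field F] [Fintype F] (x : F) :
    ∃ a b : F, a ^ 2 + b ^ 2 = x := by
  by_cases h2 : ringChar F = 2
  · obtain ⟨a, ha⟩ := FiniteField.isSquare_of_char_two h2 x
    exact ⟨a, 0, by rw [ha]; ring⟩
  · obtain ⟨a, b, hab⟩ := FiniteField.exists_root_sum_quadratic (R := F)
      (Polynomial.degree_X_pow 2) (Polynomial.degree_X_pow_sub_C (n := 2) (by decide) x)
      (FiniteField.odd_card_of_char_ne_two h2)
    refine ⟨a, b, ?_⟩
    simp only [Polynomial.eval_pow, Polynomial.eval_X, Polynomial.eval_sub,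
      Polynomial.eval_C] at hab
    linear_combination hab

lemma MulAction.ncard_range_smul {G H Ω : Type*} [Group G] [Group H] [MulAction G Ω] (φ : H →* G)
    (α : Ω) : (Set.range fun x => φ x • α).ncard = ((stabilizer G α).comap φ).index := by
  let _ := MulAction.compHom Ω φ
  exact (index_stabilizer H α).symm

variable {F : Type*} [Field F] {Ω : Type*} [MulAction SL(2, F) Ω]

namespace SL2

/-- The upper unipotent matrices that fix `α`. -/
def unipotentStabilizer (α : Ω) : Subgroup (Multiplicative F) :=
  (stabilizer SL(2, F) α).comap unipotent

lemma mem_unipotentStabilizer {α : Ω} {s : F} :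
    Multiplicative.ofAdd s ∈ unipotentStabilizer α ↔ u s • α = α := Iff.rfl

lemma ncard_range_u (α : Ω) :
    (Set.range fun s : F => u s • α).ncard = (unipotentStabilizer (F := F) α).index :=
  ncard_range_smul (unipotent (F := F)) α

lemma u_smul_diagonal_smul (a : Fˣ) (s : F) (α : Ω) :
    u ((a : F) ^ 2 * s) • diagonal a • α = diagonal a • u s • α := by
  rw [smul_smul, smul_smul, diagonal_mul_u]

lemma u_smul_diagonal_smul_eq_iff (a : Fˣ) (s : F) (α : Ω) :
    u ((a : F) ^ 2 * s) • diagonal a • α = diagonal a • α ↔ u s • α = α := by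
  rw [u_smul_diagonal_smul]
  exact (MulAction.injective _).eq_iff

lemma u_smul_u_smul_eq_iff (x s : F) (α : Ω) : u x • u s • α = u s • α ↔ u x • α = α := by
  rw [smul_smul, u_mul_comm, ← smul_smul]
  exact (MulAction.injective _).eq_iff

lemma index_unipotentStabilizer_diagonal (a : Fˣ) (α : Ω) :
    (unipotentStabilizer (F := F) (diagonal a • α)).index =
      (unipotentStabilizer (F := F) α).index := by
  rw [← ncard_range_u, ← ncard_range_u,
    ← Set.ncard_image_of_injective (Set.range fun s : F => u s • α)
      (MulAction.injective (diagonal a)), ← Set.range_comp]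
  congr 1
  ext x
  constructor
  · rintro ⟨s, rfl⟩
    refine ⟨((a : F) ^ 2)⁻¹ * s, ?_⟩
    simp only [Function.comp]
    rw [← u_smul_diagonal_smul, mul_inv_cancel_left₀ (pow_ne_zero _ a.ne_zero)]
  · rintro ⟨s, rfl⟩
    exact ⟨(a : F) ^ 2 * s, u_smul_diagonal_smul a s α⟩

lemma exists_ne_zero_mem [Fintype F] {H : Subgroup (Multiplicative F)}
    (hH : H.index < Fintype.card F) : ∃ s : F, s ≠ 0 ∧ Multiplicative.ofAdd s ∈ H := by
  rcases H.bot_or_exists_ne_one with rfl | ⟨x, hx, hx1⟩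
  · rw [Subgroup.index_bot, ← Nat.card_eq_fintype_card (α := F)] at hH
    exact absurd hH (lt_irrefl _)
  · exact ⟨x.toAdd, fun h => hx1 (toAdd_eq_zero.1 h), hx⟩

lemma exists_u_smul_eq {β γ : Ω}
    (h : ¬ Disjoint (Set.range fun s : F => u s • β) (Set.range fun s : F => u s • γ)) :
    ∃ s : F, u s • β = γ := by
  rw [Set.not_disjoint_iff] at h
  obtain ⟨_, ⟨s, rfl⟩, ⟨t, ht⟩⟩ := h
  refine ⟨-t + s, ?_⟩
  have ht : u t • γ = u s • β := ht
  rw [u_add, mul_smul, ← ht, ← mul_smul, ← u_add, neg_add_cancel, u_zero, one_smul]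

namespace FixityFour

lemma range_u_subset {t : F} {β : Ω} (ht : u t • β = β) :
    (Set.range fun s : F => u s • β) ⊆ {x : Ω | u t • x = x} := by
  rintro _ ⟨s, rfl⟩
  exact (u_smul_u_smul_eq_iff t s β).2 ht

lemma ncard_fixed_u_le (h : FixityFour F Ω) {t : F} (ht : t ≠ 0) :
    {x : Ω | u t • x = x}.ncard ≤ 4 :=
  h.ncard_le _ fun hc => ht (u_mem_center hc)

/-- If the unipotent matrices fixing `α` have index at least three, they are normalized by the
diagonal matrices. -/
lemma u_sq_smul_eq [Fintype F] [Finite Ω] (h : FixityFour F Ω) (hq : 17 ≤ Fintype.card F) {α : Ω}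
    (h3 : 3 ≤ (unipotentStabilizer (F := F) α).index)
    (h4 : (unipotentStabilizer (F := F) α).index ≤ 4) (a : Fˣ) {s : F} (hs : u s • α = α) :
    u ((a : F) ^ 2 * s) • α = α := by
  have hd := index_unipotentStabilizer_diagonal a α
  obtain ⟨x, hx0, hx⟩ := exists_ne_zero_mem
    (H := unipotentStabilizer (F := F) α ⊓ unipotentStabilizer (diagonal a • α)) (by
      refine (Subgroup.index_inf_le.trans ?_).trans_lt (show 4 * 4 < _ by omega)
      rw [hd]
      exact Nat.mul_le_mul h4 h4)
  obtain ⟨hx1, hx2⟩ := Subgroup.mem_inf.1 hx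
  obtain ⟨y, hy⟩ : ∃ y : F, u y • α = diagonal a • α := by
    apply exists_u_smul_eq
    intro hdisj
    have hsub := Set.union_subset (range_u_subset hx1) (range_u_subset hx2)
    have := (Set.ncard_le_ncard hsub).trans (h.ncard_fixed_u_le hx0)
    rw [Set.ncard_union_eq hdisj, ncard_range_u, ncard_range_u, hd] at this
    omega
  have := (u_smul_diagonal_smul_eq_iff a s α).2 hs
  rwa [← hy, u_smul_u_smul_eq_iff] at this

lemma u_pow_four_smul_eq [Fintype F] [Finite Ω] (h : FixityFour F Ω) (hq : 17 ≤ Fintype.card F) {α : Ω}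
    (h2 : (unipotentStabilizer (F := F) α).index = 2) (a : Fˣ) {s : F} (hs : u s • α = α) :
    u ((a : F) ^ 4 * s) • α = α := by
  have hd := index_unipotentStabilizer_diagonal a α
  have hd' := index_unipotentStabilizer_diagonal a (diagonal a • α)
  rw [h2] at hd
  rw [hd] at hd'
  obtain ⟨x, hx0, hx⟩ := exists_ne_zero_mem
    (H := unipotentStabilizer (F := F) α ⊓ (unipotentStabilizer (diagonal a • α) ⊓
      unipotentStabilizer (diagonal a • diagonal a • α))) (by
      refine (Subgroup.index_inf_le.trans
        (Nat.mul_le_mul_left _ Subgroup.index_inf_le)).trans_lt ?_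
      rw [hd, hd', h2]
      omega)
  obtain ⟨hx1, hx23⟩ := Subgroup.mem_inf.1 hx
  obtain ⟨hx2, hx3⟩ := Subgroup.mem_inf.1 hx23
  have key : (∃ y : F, u y • α = diagonal a • α) ∨
      (∃ y : F, u y • α = diagonal a • diagonal a • α) ∨
      (∃ y : F, u y • diagonal a • α = diagonal a • diagonal a • α) := by
    by_contra hno
    rw [not_or, not_or] at hno
    obtain ⟨n1, n2, n3⟩ := hno
    have d1 := not_not.1 (mt exists_u_smul_eq n1)
    have d2 := not_not.1 (mt exists_u_smul_eq n2)
    have d3 := not_not.1 (mt exists_u_smul_eq n3)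
    have hsub := Set.union_subset (range_u_subset hx1)
      (Set.union_subset (range_u_subset hx2) (range_u_subset hx3))
    have := (Set.ncard_le_ncard hsub).trans (h.ncard_fixed_u_le hx0)
    rw [Set.ncard_union_eq (Set.disjoint_union_right.2 ⟨d1, d2⟩), Set.ncard_union_eq d3,
      ncard_range_u, ncard_range_u, ncard_range_u, hd, hd', h2] at this
    omega
  have hsq : (∀ {s : F}, u s • α = α → u ((a : F) ^ 2 * s) • α = α) →
      u ((a : F) ^ 4 * s) • α = α := by
    intro hh
    have := hh (hh hs)
    rwa [← mul_assoc, ← pow_add] at this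
  rcases key with ⟨y, hy⟩ | ⟨y, hy⟩ | ⟨y, hy⟩
  · apply hsq
    intro s hs
    have := (u_smul_diagonal_smul_eq_iff a s α).2 hs
    rwa [← hy, u_smul_u_smul_eq_iff] at this
  · have := (u_smul_diagonal_smul_eq_iff a _ _).2 ((u_smul_diagonal_smul_eq_iff a s α).2 hs)
    rwa [← hy, u_smul_u_smul_eq_iff, ← mul_assoc, ← pow_add] at this
  · apply hsq
    intro s hs
    have := (u_smul_diagonal_smul_eq_iff a _ _).2 ((u_smul_diagonal_smul_eq_iff a s α).2 hs)
    rwa [← hy, u_smul_u_smul_eq_iff, u_smul_diagonal_smul_eq_iff] at this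

/-- A point fixed by a nontrivial upper unipotent matrix is fixed by all of them. -/
theorem u_smul_eq [Fintype F] [Finite Ω] (h : FixityFour F Ω) (hq : 17 ≤ Fintype.card F) {α : Ω} {t : F}
    (ht0 : t ≠ 0) (ht : u t • α = α) (s : F) : u s • α = α := by
  have hle : (unipotentStabilizer (F := F) α).index ≤ 4 := by
    rw [← ncard_range_u]
    exact (Set.ncard_le_ncard (range_u_subset ht)).trans (h.ncard_fixed_u_le ht0)
  have hpos : (unipotentStabilizer (F := F) α).index ≠ 0 := Subgroup.index_ne_zero_of_finite
  have hadd : ∀ x y : F, u x • α = α → u y • α = α → u (x + y) • α = α := by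
    intro x y hx hy
    rw [u_add, mul_smul, hy, hx]
  have hz : u (0 : F) • α = α := by rw [u_zero, one_smul]
  rcases Nat.lt_or_ge (unipotentStabilizer (F := F) α).index 3 with h3 | h3
  · by_contra hs
    have h2 : (unipotentStabilizer (F := F) α).index = 2 := by
      have : (unipotentStabilizer (F := F) α).index ≠ 1 := by
        intro h1
        rw [Subgroup.index_eq_one] at h1
        apply hs
        rw [← mem_unipotentStabilizer, h1]
        exact Subgroup.mem_top _
      omega
    have hdbl : ∀ x : F, u (x + x) • α = α := fun x =>
      Subgroup.mul_self_mem_of_index_two h2 (Multiplicative.ofAdd x)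
    have hchar : (2 : F) = 0 := by
      by_contra h2
      apply hs
      have := hdbl (s / 2)
      rwa [← mul_two, div_mul_cancel₀ _ h2] at this
    have hchar2 : ringChar F = 2 :=
      have := CharTwo.of_one_ne_zero_of_two_eq_zero (one_ne_zero (α := F)) hchar
      ringChar.eq F 2
    obtain ⟨a, ha⟩ := FiniteField.isSquare_of_char_two hchar2 (s / t)
    obtain ⟨b, rfl⟩ := FiniteField.isSquare_of_char_two hchar2 a
    by_cases hb : b = 0
    · rw [hb, zero_mul, zero_mul, div_eq_zero_iff] at ha
      rw [ha.resolve_right ht0] at hs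
      exact hs hz
    · have := h.u_pow_four_smul_eq hq h2 (Units.mk0 b hb) ht
      rw [Units.val_mk0, show b ^ 4 = b * b * (b * b) by ring, ← ha, div_mul_cancel₀ _ ht0] at this
      exact hs this
  · have hmul : ∀ a : F, u (a ^ 2 * t) • α = α := by
      intro a
      by_cases ha : a = 0
      · rw [ha]; simpa using hz
      · exact h.u_sq_smul_eq hq h3 hle (Units.mk0 a ha) ht
    obtain ⟨a, b, hab⟩ := FiniteField.exists_sq_add_sq_eq (s / t)
    have := hadd _ _ (hmul a) (hmul b)
    rwa [← add_mul, hab, div_mul_cancel₀ _ ht0] at this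

end FixityFour

end SL2

end UnipotentFixedPoints
section BorelStabilizer

open Matrix Matrix.SpecialLinearGroup MatrixGroups MulAction

variable {F : Type*} [Field F] {Ω : Type*} [MulAction SL(2, F) Ω]

namespace SL2

lemma conj_lower_left (g y : SL(2, F)) : (y⁻¹ * g * y) 1 0 =
    y 0 0 * (g 1 0 * y 0 0 + g 1 1 * y 1 0) - y 1 0 * (g 0 0 * y 0 0 + g 0 1 * y 1 0) := by
  obtain ⟨-, -, h3, h4⟩ := inv_entries y
  rw [mul_assoc, mul_entry, mul_entry, mul_entry, h3, h4]
  ring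

namespace FixityFour

/-- A point stabilizer containing the upper unipotent matrices is upper triangular. -/
lemma lower_left_eq_zero (h : FixityFour F Ω) {α : Ω} (hu : ∀ s : F, u s • α = α)
    {g : SL(2, F)} (hg : g • α = α) : g 1 0 = 0 := by
  by_contra hc
  have htop := eq_top_of_unipotent_le (K := stabilizer SL(2, F) α) hu hg hc
  obtain ⟨k, -, -, hk4⟩ := h.exists_mem_stabilizer α
  have hall : ∀ x, x = α := by
    intro x
    obtain ⟨y, rfl⟩ := h.trans α x
    have : y ∈ stabilizer SL(2, F) α := htop ▸ Subgroup.mem_top y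
    exact this
  have hsub : {x : Ω | k • x = x} ⊆ {α} := fun x _ => hall x
  have := Set.ncard_le_ncard hsub
  rw [Set.ncard_singleton] at this
  omega

/-- A point stabilizer is not the whole group of upper triangular matrices. -/
lemma exists_lower_left_eq_zero (h : FixityFour F Ω) (α : Ω) :
    ¬ ∀ g : SL(2, F), g • α = α ↔ g 1 0 = 0 := by
  intro hB
  obtain ⟨k, hk, hkc, hk4⟩ := h.exists_mem_stabilizer α
  have hk0 : k 1 0 = 0 := (hB k).1 hk
  have hk' : ¬ (k 0 1 = 0 ∧ k 0 0 = k 1 1) := fun ⟨h1, h2⟩ =>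
    hkc (mem_center_iff_entries.2 ⟨h1, hk0, h2⟩)
  have hlin : ∀ y : SL(2, F), k • y • α = y • α → y • α ≠ α →
      y 1 0 ≠ 0 ∧ (k 0 0 - k 1 1) * y 0 0 + k 0 1 * y 1 0 = 0 := by
    intro y hy hyα
    have hy0 : y 1 0 ≠ 0 := fun h0 => hyα ((hB y).2 h0)
    refine ⟨hy0, ?_⟩
    have e : (y⁻¹ * k * y) 1 0 = 0 := by
      rw [← hB, mul_smul, mul_smul, hy, inv_smul_smul]
    rw [conj_lower_left, hk0] at e
    exact (mul_eq_zero.1 (show y 1 0 * _ = 0 by linear_combination -e)).resolve_left hy0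
  have huniq : ∀ x₁ x₂ : Ω, k • x₁ = x₁ → x₁ ≠ α → k • x₂ = x₂ → x₂ ≠ α → x₁ = x₂ := by
    intro x₁ x₂ h1 h1' h2 h2'
    obtain ⟨y, rfl⟩ := h.trans α x₁
    obtain ⟨z, rfl⟩ := h.trans α x₂
    obtain ⟨hy0, ey⟩ := hlin y h1 h1'
    obtain ⟨hz0, ez⟩ := hlin z h2 h2'
    have hd : k 0 0 - k 1 1 ≠ 0 := by
      intro hd
      rw [hd, zero_mul, zero_add] at ey
      exact hk' ⟨(mul_eq_zero.1 ey).resolve_right hy0, sub_eq_zero.1 hd⟩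
    have e : (z⁻¹ * y) 1 0 = 0 := by
      obtain ⟨-, -, h3, h4⟩ := inv_entries z
      rw [mul_entry, h3, h4]
      refine (mul_eq_zero.1 (?_ : (k 0 0 - k 1 1) * _ = 0)).resolve_left hd
      linear_combination y 1 0 * ez - z 1 0 * ey
    rw [← hB, mul_smul, inv_smul_eq_iff] at e
    exact e
  have hle2 : {x : Ω | k • x = x}.ncard ≤ 2 := by
    by_cases hex : ∃ x, k • x = x ∧ x ≠ α
    · obtain ⟨x₁, h1, h1'⟩ := hex
      have hsub : {x : Ω | k • x = x} ⊆ {α, x₁} := by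
        intro x hx
        by_cases hxα : x = α
        · exact Or.inl hxα
        · exact Or.inr (huniq x x₁ hx hxα h1 h1')
      exact (Set.ncard_le_ncard hsub).trans ((Set.ncard_insert_le _ _).trans (by simp))
    · have hsub : {x : Ω | k • x = x} ⊆ {α} := by
        intro x hx
        by_contra hxα
        exact hex ⟨x, hx, hxα⟩
      exact (Set.ncard_le_ncard hsub).trans (by simp)
  omega

/-- A point stabilizer containing a nontrivial unipotent matrix consists of the upper triangular
matrices whose diagonal entries lie in the subgroup of index two of the multiplicative group. -/
theorem exists_index_two [Fintype F] [Finite Ω] (h : FixityFour F Ω) (hq : 17 ≤ Fintype.card F)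
    {α : Ω} {t : F} (ht0 : t ≠ 0) (ht : u t • α = α) :
    ∃ D : Subgroup Fˣ, 2 * Nat.card D = Fintype.card F - 1 ∧ -1 ∈ D ∧
      (∀ a ∈ D, diagonal a • α = α) ∧
      ∀ g : SL(2, F), g • α = α → ∃ s, ∃ a ∈ D, g = u s * diagonal a := by
  have hu := h.u_smul_eq hq ht0 ht
  let D : Subgroup Fˣ := (stabilizer SL(2, F) α).comap diagonal
  have hD : ∀ a, a ∈ D ↔ diagonal a • α = α := fun a => Iff.rfl
  have hdec : ∀ g : SL(2, F), g 1 0 = 0 → ∃ s, ∃ a : Fˣ, g = u s * diagonal a ∧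
      (g • α = α ↔ a ∈ D) := by
    intro g hg
    obtain ⟨s, a, rfl, -⟩ := eq_u_mul_diagonal hg
    refine ⟨s, a, rfl, ?_⟩
    rw [hD, mul_smul, smul_eq_iff_eq_inv_smul]
    have : (u s)⁻¹ • α = α := by rw [inv_smul_eq_iff, hu]
    rw [this]
  have hneg : (-1 : Fˣ) ∈ D := by
    rw [hD, diagonal_neg_one]
    exact h.center_smul _ (mem_center_iff_eq.2 (Or.inr rfl)) α
  have hcardu : Nat.card Fˣ = Fintype.card F - 1 := by
    rw [Nat.card_units, Nat.card_eq_fintype_card]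
  have hmul := D.card_mul_index
  rw [hcardu] at hmul
  have hA : (Set.range fun a : Fˣ => diagonal a • α).ncard = D.index :=
    ncard_range_smul diagonal α
  have h4 : D.index ≤ 4 := by
    rw [← hA]
    refine (Set.ncard_le_ncard (t := {x : Ω | u (1 : F) • x = x}) ?_).trans
      (h.ncard_fixed_u_le one_ne_zero)
    rintro _ ⟨a, rfl⟩
    have := (u_smul_diagonal_smul_eq_iff a (((a : F) ^ 2)⁻¹) α).2 (hu _)
    rwa [mul_inv_cancel₀ (pow_ne_zero _ a.ne_zero)] at this
  obtain ⟨a, haD, hac⟩ : ∃ a ∈ D, diagonal a ∉ Subgroup.center SL(2, F) := by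
    by_contra hno
    push Not at hno
    have hsub : (D : Set Fˣ) ⊆ {1, -1} := fun a ha => diagonal_mem_center_iff.1 (hno a ha)
    have h2 : Nat.card D ≤ 2 := by
      rw [← SetLike.coe_sort_coe, Nat.card_coe_set_eq]
      exact (Set.ncard_le_ncard hsub).trans ((Set.ncard_insert_le _ _).trans (by simp))
    have := Nat.mul_le_mul h2 h4
    omega
  have hfix : ∀ b : Fˣ, diagonal a • diagonal b • α = diagonal b • α := by
    intro b
    rw [smul_smul, ← map_mul, mul_comm, map_mul, mul_smul, (hD a).1 haD]
  let w : SL(2, F) := ⟨!![0, -1; 1, 0], by simp⟩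
  have w1 : w 0 0 = 0 := rfl
  have w2 : w 0 1 = -1 := rfl
  have w3 : w 1 0 = 1 := rfl
  have w4 : w 1 1 = 0 := rfl
  have hwd : ∀ b : Fˣ, diagonal b * w = w * diagonal b⁻¹ := by
    intro b
    obtain ⟨k1, k2, k3, k4⟩ := diagonal_entries b
    obtain ⟨l1, l2, l3, l4⟩ := diagonal_entries b⁻¹
    apply ext_entries <;>
      simp only [mul_entry, w1, w2, w3, w4, k1, k2, k3, k4, l1, l2, l3, l4,
        Units.val_inv_eq_inv_val, inv_inv] <;> ring
  set A := Set.range fun a : Fˣ => diagonal a • α with hAdef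
  set B := (fun x : Ω => w • x) '' A with hBdef
  have hBcard : B.ncard = D.index := by
    rw [hBdef, Set.ncard_image_of_injective _ (MulAction.injective w), hA]
  have hdisj : Disjoint A B := by
    rw [Set.disjoint_left]
    rintro _ ⟨b, rfl⟩ ⟨_, ⟨c, rfl⟩, hbc⟩
    have e : ((diagonal b)⁻¹ * w * diagonal c) • α = α := by
      rw [mul_smul, mul_smul, inv_smul_eq_iff]
      exact hbc
    have := h.lower_left_eq_zero hu e
    rw [← map_inv] at this
    obtain ⟨k1, k2, k3, k4⟩ := diagonal_entries c
    obtain ⟨l1, l2, l3, l4⟩ := diagonal_entries b⁻¹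
    simp only [mul_entry, w1, w2, w3, w4, k1, k3, l3, l4] at this
    simp at this
  have hle : D.index ≤ 2 := by
    have hsub : A ∪ B ⊆ {x : Ω | diagonal a • x = x} := by
      rintro _ (⟨b, rfl⟩ | ⟨_, ⟨b, rfl⟩, rfl⟩)
      · exact hfix b
      · show diagonal a • w • diagonal b • α = w • diagonal b • α
        rw [smul_smul (diagonal a), hwd, mul_smul]
        congr 1
        rw [map_inv, inv_smul_eq_iff, hfix]
    have := (Set.ncard_le_ncard hsub).trans (h.ncard_le _ hac)
    rw [Set.ncard_union_eq hdisj, hBcard, hA] at this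
    omega
  have hne1 : D.index ≠ 1 := by
    intro h1
    rw [Subgroup.index_eq_one] at h1
    apply h.exists_lower_left_eq_zero α
    intro g
    refine ⟨h.lower_left_eq_zero hu, fun hg => ?_⟩
    obtain ⟨s, b, -, hb⟩ := hdec g hg
    rw [hb, h1]
    exact Subgroup.mem_top _
  have hne0 : D.index ≠ 0 := Subgroup.index_ne_zero_of_finite
  refine ⟨D, ?_, hneg, fun a ha => ha, fun g hg => ?_⟩
  · obtain h2 : D.index = 2 := by omega
    rw [h2] at hmul
    omega
  · obtain ⟨s, b, hb, hbD⟩ := hdec g (h.lower_left_eq_zero hu hg)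
    exact ⟨s, b, hbD.1 hg, hb⟩

end FixityFour

end SL2

end BorelStabilizer

section PSL2

open Matrix Matrix.SpecialLinearGroup MatrixGroups MulAction

variable {F : Type*} [Field F] {Ω : Type*} [MulAction (PSL2 F) Ω] [MulAction SL(2, F) Ω]

namespace SL2

lemma coe_eq_one_iff {g : SL(2, F)} : (g : PSL2 F) = 1 ↔ g ∈ Subgroup.center SL(2, F) :=
  QuotientGroup.eq_one_iff g

lemma FixityFour.of_quotient [IsPretransitive (PSL2 F) Ω]
    (hsmul : ∀ (g : SL(2, F)) (x : Ω), g • x = (g : PSL2 F) • x)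
    (hfix : ∀ g : PSL2 F, g ≠ 1 → Set.ncard {ω : Ω | g • ω = ω} ≤ 4)
    (hfix4 : ∃ g : PSL2 F, g ≠ 1 ∧ Set.ncard {ω : Ω | g • ω = ω} = 4) : FixityFour F Ω where
  trans x y := by
    obtain ⟨g, hg⟩ := exists_smul_eq (PSL2 F) x y
    obtain ⟨g, rfl⟩ := QuotientGroup.mk_surjective g
    exact ⟨g, (hsmul g x).trans hg⟩
  center_smul z hz x := by rw [hsmul, coe_eq_one_iff.2 hz, one_smul]
  ncard_le g hg := by
    simp only [hsmul]
    exact hfix g (coe_eq_one_iff.not.2 hg)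
  exists_eq := by
    obtain ⟨g, hg, h⟩ := hfix4
    obtain ⟨g, rfl⟩ := QuotientGroup.mk_surjective g
    refine ⟨g, coe_eq_one_iff.not.1 hg, ?_⟩
    simp only [hsmul]
    exact h

lemma coe_mem_stabilizer_iff (hsmul : ∀ (g : SL(2, F)) (x : Ω), g • x = (g : PSL2 F) • x)
    {g : SL(2, F)} {α : Ω} : (g : PSL2 F) ∈ stabilizer (PSL2 F) α ↔ g • α = α := by
  rw [mem_stabilizer_iff, hsmul]

lemma isCyclic_stabilizer_quotient
    (hsmul : ∀ (g : SL(2, F)) (x : Ω), g • x = (g : PSL2 F) • x) (α : Ω)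
    [IsCyclic (stabilizer SL(2, F) α)] : IsCyclic (stabilizer (PSL2 F) α) := by
  have e : (stabilizer SL(2, F) α).map (QuotientGroup.mk' (Subgroup.center SL(2, F))) =
      stabilizer (PSL2 F) α := by
    have : stabilizer SL(2, F) α = (stabilizer (PSL2 F) α).comap
        (QuotientGroup.mk' (Subgroup.center SL(2, F))) := by
      ext g
      exact (coe_mem_stabilizer_iff hsmul).symm
    rw [this, Subgroup.map_comap_eq_self_of_surjective (QuotientGroup.mk'_surjective _)]
  rw [← e]
  exact isCyclic_of_surjective _ (MonoidHom.subgroupMap_surjective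
    (QuotientGroup.mk' (Subgroup.center SL(2, F))) (stabilizer SL(2, F) α))

lemma FixityFour.card_stabilizer_quotient (h : FixityFour F Ω) [Finite Ω]
    [IsPretransitive (PSL2 F) Ω] (α : Ω) :
    Nat.card (stabilizer (PSL2 F) α) * Nat.card (Subgroup.center SL(2, F)) =
      Nat.card (stabilizer SL(2, F) α) := by
  have hΩ : 0 < Nat.card Ω := @Nat.card_pos _ ⟨α⟩ _
  apply Nat.eq_of_mul_eq_mul_left hΩ
  rw [h.card_mul_card, Subgroup.card_eq_card_quotient_mul_card_subgroup (Subgroup.center SL(2, F)),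
    ← mul_assoc, ← index_stabilizer_of_transitive (PSL2 F) α, mul_comm (Subgroup.index _),
    Subgroup.card_mul_index]

lemma two_ne_zero_of_odd_card [Fintype F] (hodd : Fintype.card F % 2 = 1) : (2 : F) ≠ 0 := by
  intro h2
  have h : ringChar F ∣ 2 := ringChar.dvd (by exact_mod_cast h2)
  rcases (Nat.dvd_prime Nat.prime_two).1 h with h | h
  · exact CharP.ringChar_ne_one h
  · have := FiniteField.even_card_iff_char_two.1 h
    omega

lemma natCard_map_diagonal (h2 : (2 : F) ≠ 0) (D : Subgroup Fˣ) (hD : -1 ∈ D) (c : SL(2, F)) :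
    2 * Nat.card (D.map ((QuotientGroup.mk' (Subgroup.center SL(2, F))).comp
      ((MulAut.conj c).toMonoidHom.comp diagonal))) = Nat.card D := by
  set ψ := (QuotientGroup.mk' (Subgroup.center SL(2, F))).comp
      ((MulAut.conj c).toMonoidHom.comp diagonal) with hψ
  have hker : ∀ a : Fˣ, ψ a = 1 ↔ a = 1 ∨ a = -1 := by
    intro a
    rw [← diagonal_mem_center_iff, ← conj_mem_center_iff (k := c), ← coe_eq_one_iff]
    rfl
  have e : D.map ψ = (ψ.comp D.subtype).range := by
    rw [MonoidHom.range_comp, Subgroup.range_subtype]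
  have hne : (1 : Fˣ) ≠ -1 := by
    intro h
    apply h2
    have := congrArg Units.val h
    rw [Units.val_one, Units.val_neg, Units.val_one, eq_neg_iff_add_eq_zero] at this
    rw [← this]; norm_num
  have hk : Nat.card (ψ.comp D.subtype).ker = 2 := by
    have : ((ψ.comp D.subtype).ker : Set D) = {1, ⟨-1, hD⟩} := by
      ext a
      rw [SetLike.mem_coe, MonoidHom.mem_ker]
      simp only [MonoidHom.comp_apply, Subgroup.subtype_apply] at hker ⊢
      simp only [Set.mem_insert_iff, Set.mem_singleton_iff, Subtype.ext_iff]
      exact hker a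
    rw [← SetLike.coe_sort_coe, Nat.card_coe_set_eq, this, Set.ncard_pair]
    intro h
    exact hne (congrArg Subtype.val h)
  have := Subgroup.card_mul_index (ψ.comp D.subtype).ker
  rwa [hk, Subgroup.index_ker, ← e] at this

theorem FixityFour.exists_normal_subgroup [Fintype F] [Finite Ω] (h : FixityFour F Ω)
    (hsmul : ∀ (g : SL(2, F)) (x : Ω), g • x = (g : PSL2 F) • x)
    (hq : 17 ≤ Fintype.card F) {p : ℕ} (hp : (p : F) = 0)
    {α β : Ω} {c : SL(2, F)} (hc : c • β = α) {t : F} (ht0 : t ≠ 0) (ht : u t • β = β) :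
    Fintype.card F % 4 = 1 ∧ ∃ E C : Subgroup (PSL2 F),
      E ≤ stabilizer (PSL2 F) α ∧ C ≤ stabilizer (PSL2 F) α ∧
      (E.subgroupOf (stabilizer (PSL2 F) α)).Normal ∧
      Nat.card E = Fintype.card F ∧ (∀ x ∈ E, ∀ y ∈ E, x * y = y * x) ∧
      (∀ x ∈ E, x ^ p = 1) ∧
      IsCyclic C ∧ Nat.card C = (Fintype.card F - 1) / 4 ∧
      E ⊓ C = ⊥ ∧ E ⊔ C = stabilizer (PSL2 F) α := by
  obtain ⟨D, hDcard, hD1, hDα, hstab⟩ := h.exists_index_two hq ht0 ht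
  have hodd : Fintype.card F % 2 = 1 := by omega
  have h2 := two_ne_zero_of_odd_card hodd
  set φ := (QuotientGroup.mk' (Subgroup.center SL(2, F))).comp
      ((MulAut.conj c).toMonoidHom.comp unipotent) with hφ
  set ψ := (QuotientGroup.mk' (Subgroup.center SL(2, F))).comp
      ((MulAut.conj c).toMonoidHom.comp diagonal) with hψ
  have hφa : ∀ s : F, φ (Multiplicative.ofAdd s) = ((c * u s * c⁻¹ : SL(2, F)) : PSL2 F) :=
    fun s => rfl
  have hψa : ∀ a : Fˣ, ψ a = ((c * diagonal a * c⁻¹ : SL(2, F)) : PSL2 F) := fun a => rfl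
  have hc' : c⁻¹ • α = β := by rw [← hc, inv_smul_smul]
  have hφs : ∀ s : Multiplicative F, φ s ∈ stabilizer (PSL2 F) α := by
    intro s
    refine (coe_mem_stabilizer_iff hsmul (g := c * u s.toAdd * c⁻¹)).2 ?_
    rw [mul_smul, mul_smul, hc', h.u_smul_eq hq ht0 ht, hc]
  have hψs : ∀ a ∈ D, ψ a ∈ stabilizer (PSL2 F) α := by
    intro a ha
    refine (coe_mem_stabilizer_iff hsmul (g := c * diagonal a * c⁻¹)).2 ?_
    rw [mul_smul, mul_smul, hc', hDα a ha, hc]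
  have hdec : ∀ x ∈ stabilizer (PSL2 F) α, ∃ s, ∃ a ∈ D, x = φ s * ψ a := by
    intro x hx
    obtain ⟨g, rfl⟩ := QuotientGroup.mk_surjective x
    have hg : g • α = α := (coe_mem_stabilizer_iff hsmul).1 hx
    obtain ⟨s, a, ha, e⟩ := hstab (c⁻¹ * g * c) (by rw [mul_smul, mul_smul, hc, hg, hc'])
    refine ⟨Multiplicative.ofAdd s, a, ha, ?_⟩
    rw [hφa, hψa, ← QuotientGroup.mk_mul]
    congr 1
    have : g = c * (c⁻¹ * g * c) * c⁻¹ := by group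
    rw [this, e]
    group
  have hφinj : Function.Injective φ := by
    rw [injective_iff_map_eq_one]
    intro s hs
    have : u s.toAdd ∈ Subgroup.center SL(2, F) :=
      conj_mem_center_iff.1 (coe_eq_one_iff.1 ((hφa s.toAdd).symm.trans hs))
    exact Multiplicative.toAdd.injective (u_mem_center this)
  have hconj : ∀ (a : Fˣ) (s : F), ψ a * φ (Multiplicative.ofAdd s) * (ψ a)⁻¹ =
      φ (Multiplicative.ofAdd ((a : F) ^ 2 * s)) := by
    intro a s
    rw [mul_inv_eq_iff_eq_mul]
    simp only [hφ, hψ, MonoidHom.comp_apply, ← map_mul]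
    exact congrArg _ (congrArg _ (diagonal_mul_u a s))
  have hEle : φ.range ≤ stabilizer (PSL2 F) α := by
    rintro _ ⟨s, rfl⟩
    exact hφs s
  have hCle : D.map ψ ≤ stabilizer (PSL2 F) α := by
    rintro _ ⟨a, ha, rfl⟩
    exact hψs a ha
  have hCcard : 2 * Nat.card (D.map ψ) = Nat.card D := natCard_map_diagonal h2 D hD1 c
  have hC : Nat.card (D.map ψ) = (Fintype.card F - 1) / 4 := by omega
  refine ⟨by omega, φ.range, D.map ψ, hEle, hCle, ⟨?_⟩, ?_, ?_, ?_, ?_, hC, ?_, ?_⟩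
  · rintro ⟨_, hn⟩ ⟨s, rfl⟩ ⟨g, hg⟩
    obtain ⟨r, a, ha, rfl⟩ := hdec g hg
    refine ⟨r * Multiplicative.ofAdd ((a : F) ^ 2 * s.toAdd) * r⁻¹, ?_⟩
    rw [map_mul, map_mul, ← hconj, map_inv]
    simp [mul_assoc]
  · rw [Nat.card_congr (MonoidHom.ofInjective hφinj).symm.toEquiv, ← Nat.card_eq_fintype_card]
    exact Nat.card_congr Multiplicative.toAdd
  · rintro _ ⟨s, rfl⟩ _ ⟨r, rfl⟩
    rw [← map_mul, mul_comm, map_mul]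
  · rintro _ ⟨s, rfl⟩
    rw [← map_pow]
    have : s ^ p = 1 := by
      apply Multiplicative.toAdd.injective
      rw [toAdd_pow, nsmul_eq_mul, hp, zero_mul, toAdd_one]
    rw [this, map_one]
  · exact isCyclic_of_surjective _ (MonoidHom.subgroupMap_surjective ψ D)
  · rw [eq_bot_iff]
    rintro _ ⟨⟨s, rfl⟩, ⟨a, ha, e⟩⟩
    have hz : c * ((u s.toAdd)⁻¹ * diagonal a) * c⁻¹ ∈ Subgroup.center SL(2, F) := by
      rw [← coe_eq_one_iff]
      have : (φ s)⁻¹ * ψ a = 1 := by rw [e, inv_mul_cancel]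
      rw [← this, ← map_inv]
      simp only [hφ, hψ, MonoidHom.comp_apply, ← map_mul, ← map_inv]
      rfl
    have hz := (mem_center_iff_entries.1 (conj_mem_center_iff.1 hz)).1
    obtain ⟨h1, h2, h3, h4⟩ := u_entries (-s.toAdd)
    obtain ⟨k1, k2, k3, k4⟩ := diagonal_entries a
    have hu : (u s.toAdd)⁻¹ = u (-s.toAdd) := by
      rw [u, ← map_inv]; rfl
    rw [hu, mul_entry, h1, h2, k2, k4] at hz
    have hs : s = 1 := by
      apply Multiplicative.toAdd.injective
      rw [toAdd_one]
      simpa using hz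
    rw [hs, map_one]
    exact Subgroup.mem_bot.2 rfl
  · refine le_antisymm (sup_le hEle hCle) ?_
    intro x hx
    obtain ⟨s, a, ha, rfl⟩ := hdec x hx
    exact Subgroup.mul_mem_sup ⟨s, rfl⟩ ⟨a, ha, rfl⟩

end SL2

end PSL2

/-- Let `q = p^f ≥ 17` be a prime power and `G = PSL₂(q)`.  If `G`
acts transitively, faithfully and with fixity 4 on a finite set `Ω` and `α ∈ Ω`, then
`p` is odd and: either `q ≡ 1 (mod 4)` and `G_α` is cyclic of order `(q-1)/4` or a
semidirect product of a normal elementary abelian subgroup `E` of order `q` with a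
cyclic subgroup `C` of order `(q-1)/4`; or `q ≡ 3 (mod 4)` and `G_α` is cyclic of
order `(q+1)/4`. -/
theorem stmt_13 {p f q : ℕ} (hp : p.Prime) (hf : 1 ≤ f) (hq : q = p ^ f) (hq17 : 17 ≤ q)
    (F : Type*) [Field F] [Fintype F] (hF : Fintype.card F = q)
    {Ω : Type*} [Finite Ω] [MulAction (PSL2 F) Ω]
    [MulAction.IsPretransitive (PSL2 F) Ω] [FaithfulSMul (PSL2 F) Ω]
    (hfix : ∀ g : PSL2 F, g ≠ 1 → Set.ncard {ω : Ω | g • ω = ω} ≤ 4)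
    (hfix4 : ∃ g : PSL2 F, g ≠ 1 ∧ Set.ncard {ω : Ω | g • ω = ω} = 4)
    (α : Ω) :
    Odd p ∧
      ((q % 4 = 1 ∧
          ((IsCyclic ↥(MulAction.stabilizer (PSL2 F) α) ∧
              Nat.card ↥(MulAction.stabilizer (PSL2 F) α) = (q - 1) / 4)
            ∨ (∃ E C : Subgroup (PSL2 F),
                E ≤ MulAction.stabilizer (PSL2 F) α ∧ C ≤ MulAction.stabilizer (PSL2 F) α ∧
                (E.subgroupOf (MulAction.stabilizer (PSL2 F) α)).Normal ∧
                Nat.card ↥E = q ∧ (∀ x ∈ E, ∀ y ∈ E, x * y = y * x) ∧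
                (∀ x ∈ E, x ^ p = 1) ∧
                IsCyclic ↥C ∧ Nat.card ↥C = (q - 1) / 4 ∧
                E ⊓ C = ⊥ ∧ E ⊔ C = MulAction.stabilizer (PSL2 F) α)))
        ∨ (q % 4 = 3 ∧ IsCyclic ↥(MulAction.stabilizer (PSL2 F) α) ∧
            Nat.card ↥(MulAction.stabilizer (PSL2 F) α) = (q + 1) / 4)) := by
  have hp0 : (p : F) = 0 := by
    have := FiniteField.cast_card_eq_zero F
    rw [hF, hq, Nat.cast_pow] at this
    exact eq_zero_of_pow_eq_zero this
  let _ : MulAction (Matrix.SpecialLinearGroup (Fin 2) F) Ω :=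
    MulAction.compHom Ω (QuotientGroup.mk' (Subgroup.center (Matrix.SpecialLinearGroup (Fin 2) F)))
  have hsmul : ∀ (g : (Matrix.SpecialLinearGroup (Fin 2) F)) (x : Ω), g • x = (g : PSL2 F) • x := fun _ _ => rfl
  have h := SL2.FixityFour.of_quotient hsmul hfix hfix4
  have hq17F : 17 ≤ Fintype.card F := hF ▸ hq17
  have hpodd : q % 2 = 1 → Odd p := by
    intro hq2
    by_contra hpe
    have : Even q := by
      rw [hq, Nat.even_pow]
      exact ⟨Nat.not_odd_iff_even.1 hpe, by omega⟩
    rw [Nat.even_iff] at this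
    omega
  by_cases hK : ∀ g ∈ MulAction.stabilizer (Matrix.SpecialLinearGroup (Fin 2) F) α, g ∉ Subgroup.center (Matrix.SpecialLinearGroup (Fin 2) F) →
      SL2.tr g ^ 2 ≠ 4
  · obtain ⟨hcyc, hcard⟩ := h.isCyclic_stabilizer hq17F α hK
    rw [hF] at hcard
    have hodd : q % 2 = 1 := by omega
    have h2 : (2 : F) ≠ 0 := SL2.two_ne_zero_of_odd_card (hF ▸ hodd)
    have hc := h.card_stabilizer_quotient α
    rw [SL2.natCard_center h2] at hc
    have hcyc' := SL2.isCyclic_stabilizer_quotient hsmul α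
    refine ⟨hpodd hodd, ?_⟩
    rcases hcard with hcard | hcard
    · exact Or.inl ⟨by omega, Or.inl ⟨hcyc', by omega⟩⟩
    · exact Or.inr ⟨by omega, hcyc', by omega⟩
  · push Not at hK
    obtain ⟨g, hgα, hgc, hgt⟩ := hK
    obtain ⟨g, hgα, hgc, hgt⟩ : ∃ g ∈ MulAction.stabilizer (Matrix.SpecialLinearGroup (Fin 2) F) α,
        g ∉ Subgroup.center (Matrix.SpecialLinearGroup (Fin 2) F) ∧ SL2.tr g = 2 := by
      have : (SL2.tr g - 2) * (SL2.tr g + 2) = 0 := by linear_combination hgt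
      have hneg : (-1 : (Matrix.SpecialLinearGroup (Fin 2) F)) ∈ Subgroup.center (Matrix.SpecialLinearGroup (Fin 2) F) := SL2.mem_center_iff_eq.2 (Or.inr rfl)
      rcases mul_eq_zero.1 this with h' | h'
      · exact ⟨g, hgα, hgc, sub_eq_zero.1 h'⟩
      · refine ⟨-1 * g, mul_mem (h.center_le α hneg) hgα, ?_, ?_⟩
        · rwa [Subgroup.mul_mem_cancel_left _ hneg]
        · rw [neg_one_mul, SL2.tr]
          have : SL2.tr g = -2 := eq_neg_of_add_eq_zero_left h'
          rw [SL2.tr] at this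
          simp only [Matrix.SpecialLinearGroup.coe_neg, Matrix.neg_apply]
          linear_combination -this
    obtain ⟨k, t, ht0, hk⟩ := SL2.exists_conj_eq_u hgc hgt
    have ht : SL2.u t • (k • α) = k • α := by
      rw [← hk, mul_smul, mul_smul, inv_smul_smul, MulAction.mem_stabilizer_iff.1 hgα]
    have hmain := h.exists_normal_subgroup hsmul hq17F hp0 (inv_smul_smul k α) ht0 ht
    rw [hF] at hmain
    exact ⟨hpodd (by omega), Or.inl ⟨hmain.1, Or.inr hmain.2⟩⟩
end

section
/- Suppose that the finite group G acts transitively, faithfully and with fixity 4 on a finite set Ω, that for some (equivalently every) α ∈ Ω the order of G_α is coprime to 6, and that α, β, γ, δ ∈ Ω are four distinct points such that the pointwise stabilizer H of Δ := {α, β, γ, δ} in G is a nontrivial subgroup. Then: (a) in the action of G on the coset space G/H by multiplication, every nontrivial element of G fixes either 0 or exactly 4 cosets; (b) either G_α = H, or for every g ∈ G_α with g ∉ H one has H ∩ gHg⁻¹ = 1 (so that G_α is a Frobenius group with complement H); and (c) |H| is coprime to |Ω|. -/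
/-- An element of prime order `p` fixes, modulo `p`, as many points as there are. -/
theorem card_modEq_ncard_fixed {K X : Type*} [Group K] [Finite X] [MulAction K X]
    {p : ℕ} (hp : p.Prime) {h : K} (h_ord : orderOf h = p) :
    Nat.card X ≡ Set.ncard {x : X | h • x = x} [MOD p] := by
  have := Fact.mk hp
  have hP : IsPGroup p (Subgroup.zpowers h) :=
    IsPGroup.of_card (n := 1) (by rw [Nat.card_zpowers, h_ord, pow_one])
  have key := hP.card_modEq_card_fixedPoints X
  have hset : MulAction.fixedPoints (Subgroup.zpowers h) X = {x : X | h • x = x} := by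
    ext x
    constructor
    · intro hx
      exact hx ⟨h, Subgroup.mem_zpowers h⟩
    · rintro hx ⟨_, k, rfl⟩
      have hmem : h ∈ MulAction.stabilizer K x := hx
      exact zpow_mem hmem k
  rwa [Nat.card_coe_set_eq, hset] at key

/-- The sixth power of a group element permuting three points fixes each of them. -/
theorem pow_six_smul_of_mem_triple {K X : Type*} [Group K] [MulAction K X] (x : K) {b c d : X}
    (hbc : b ≠ c) (hbd : b ≠ d) (hcd : c ≠ d)
    (hb : x • b = b ∨ x • b = c ∨ x • b = d) (hc : x • c = b ∨ x • c = c ∨ x • c = d)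
    (hd : x • d = b ∨ x • d = c ∨ x • d = d) :
    x ^ 6 • b = b ∧ x ^ 6 • c = c ∧ x ^ 6 • d = d := by
  have ibc : x • b ≠ x • c := fun e => hbc (MulAction.injective x e)
  have ibd : x • b ≠ x • d := fun e => hbd (MulAction.injective x e)
  have icd : x • c ≠ x • d := fun e => hcd (MulAction.injective x e)
  rcases hb with hb | hb | hb <;> rcases hc with hc | hc | hc <;> rcases hd with hd | hd | hd <;>
    first
    | exact absurd (hb.trans hc.symm) ibc
    | exact absurd (hb.trans hd.symm) ibd
    | exact absurd (hc.trans hd.symm) icd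
    | simp [pow_succ, mul_smul, hb, hc, hd]

/-- An element of order coprime to `n` lies in every subgroup containing its `n`-th power. -/
theorem Subgroup.mem_of_pow_mem_of_coprime {K : Type*} [Group K] {S : Subgroup K} {x : K} {n : ℕ}
    (hx : (orderOf x).Coprime n) (hn : x ^ n ∈ S) : x ∈ S := by
  obtain ⟨m, hm⟩ := exists_pow_eq_self_of_coprime hx.symm
  rw [← hm]
  exact pow_mem hn m


/-- Let the finite group `G` act transitively, faithfully and with
fixity 4 on a finite set `Ω`, with `|G_α|` coprime to 6, and let `H ≠ 1` be the
pointwise stabilizer of four distinct points `α, β, γ, δ`.  Then (a) in the action of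
`G` on `G/H` every nontrivial element fixes 0 or exactly 4 cosets, (b) `G_α = H` or
`G_α` is a Frobenius group with complement `H`, and (c) `|H|` is coprime to `|Ω|`. -/
theorem stmt_18 {G : Type*} [Group G] [Finite G] {Ω : Type*} [Finite Ω] [MulAction G Ω]
    [MulAction.IsPretransitive G Ω] [FaithfulSMul G Ω]
    (hfix : ∀ g : G, g ≠ 1 → Set.ncard {ω : Ω | g • ω = ω} ≤ 4)
    (hfix4 : ∃ g : G, g ≠ 1 ∧ Set.ncard {ω : Ω | g • ω = ω} = 4)
    (α β γ δ : Ω)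
    (hdist : α ≠ β ∧ α ≠ γ ∧ α ≠ δ ∧ β ≠ γ ∧ β ≠ δ ∧ γ ≠ δ)
    (hcop : Nat.Coprime (Nat.card ↥(MulAction.stabilizer G α)) 6)
    (H : Subgroup G) (hHne : H ≠ ⊥)
    (hH : ∀ g : G, g ∈ H ↔ g • α = α ∧ g • β = β ∧ g • γ = γ ∧ g • δ = δ) :
    (∀ g : G, g ≠ 1 →
        Set.ncard {c : G ⧸ H | g • c = c} = 0 ∨ Set.ncard {c : G ⧸ H | g • c = c} = 4)
      ∧ (MulAction.stabilizer G α = H ∨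
          ∀ g ∈ MulAction.stabilizer G α, g ∉ H →
            H ⊓ H.map (MulAut.conj g).toMonoidHom = ⊥)
      ∧ Nat.Coprime (Nat.card ↥H) (Nat.card Ω) := by
  obtain ⟨hab, hac, had, hbc, hbd, hcd⟩ := hdist
  set Δ : Set Ω := {α, β, γ, δ} with hΔ
  have memΔ : ∀ x, x ∈ Δ ↔ x = α ∨ x = β ∨ x = γ ∨ x = δ := by simp [hΔ]
  have hcardΔ : Δ.ncard = 4 := by
    rw [hΔ, Set.ncard_insert_of_notMem (by simp [*]), Set.ncard_insert_of_notMem (by simp [*]),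
      Set.ncard_pair hcd]
  have fixΔ : ∀ h ∈ H, ∀ d ∈ Δ, h • d = d := by
    intro h hh d hd
    obtain ⟨h1, h2, h3, h4⟩ := (hH h).1 hh
    rcases (memΔ d).1 hd with rfl | rfl | rfl | rfl <;> assumption
  have memH : ∀ h : G, (∀ d ∈ Δ, h • d = d) → h ∈ H := fun h hd =>
    (hH h).2 ⟨hd _ (by simp [hΔ]), hd _ (by simp [hΔ]), hd _ (by simp [hΔ]), hd _ (by simp [hΔ])⟩
  have fixset : ∀ h ∈ H, h ≠ 1 → {ω : Ω | h • ω = ω} = Δ := by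
    intro h hh h1
    refine (Set.eq_of_subset_of_ncard_le (fun d hd => fixΔ h hh d hd) ?_).symm
    rw [hcardΔ]
    exact hfix h h1
  have conj_mem : ∀ h ∈ H, h ≠ 1 → ∀ x : G, x⁻¹ * h * x ∈ H ↔ ∀ d ∈ Δ, x • d ∈ Δ := by
    intro h hh h1 x
    constructor
    · intro hx d hd
      rw [← fixset h hh h1]
      have := fixΔ _ hx d hd
      rwa [mul_smul, mul_smul, inv_smul_eq_iff] at this
    · intro hx
      refine memH _ fun d hd => ?_
      rw [mul_smul, mul_smul, inv_smul_eq_iff]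
      exact fixΔ h hh _ (hx d hd)
  have stab_mem : ∀ x : G, (∀ d ∈ Δ, x • d ∈ Δ) → x • α = α → x ∈ H := by
    intro x hx hxα
    have step : ∀ d ∈ Δ, α ≠ d → x • d = β ∨ x • d = γ ∨ x • d = δ := by
      intro d hd hne
      refine ((memΔ _).1 (hx d hd)).resolve_left fun e => hne ?_
      exact MulAction.injective x (hxα.trans e.symm)
    have h6 := pow_six_smul_of_mem_triple x hbc hbd hcd (step β (by simp [hΔ]) hab)
      (step γ (by simp [hΔ]) hac) (step δ (by simp [hΔ]) had)
    have hxs : x ∈ MulAction.stabilizer G α := hxα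
    refine Subgroup.mem_of_pow_mem_of_coprime (n := 6) ?_ ((hH _).2 ⟨pow_mem hxs 6, h6⟩)
    exact hcop.coprime_dvd_left (Subgroup.orderOf_dvd_natCard _ hxs)
  have hHα : H ≤ MulAction.stabilizer G α := fun h hh => ((hH h).1 hh).1
  have five_le : ∀ p : ℕ, p.Prime → p ∣ Nat.card H → 5 ≤ p := by
    intro p hp hpd
    have hc : p.Coprime 6 :=
      hcop.coprime_dvd_left (hpd.trans (Subgroup.card_dvd_of_le hHα))
    by_contra! hlt
    have := hp.two_le
    interval_cases p
    · exact absurd hc (by decide)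
    · exact absurd hc (by decide)
    · exact absurd hp (by decide)
  have exists_order : ∀ p : ℕ, p.Prime → p ∣ Nat.card H → ∃ h ∈ H, h ≠ 1 ∧ orderOf h = p := by
    intro p hp hpd
    have := Fact.mk hp
    obtain ⟨h, hh⟩ := exists_prime_orderOf_dvd_card' p hpd
    refine ⟨h, h.2, ?_, by rw [Subgroup.orderOf_coe, hh]⟩
    intro e
    rw [← Subgroup.orderOf_coe, e, orderOf_one] at hh
    exact hp.one_lt.ne hh
  have cardΩ : ∀ p : ℕ, p.Prime → p ∣ Nat.card H → Nat.card Ω ≡ 4 [MOD p] := by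
    intro p hp hpd
    obtain ⟨h, hh, h1, ho⟩ := exists_order p hp hpd
    have := card_modEq_ncard_fixed (X := Ω) hp ho
    rwa [fixset h hh h1, hcardΔ] at this
  have fix_iff : ∀ h x : G, h • (x : G ⧸ H) = x ↔ x⁻¹ * h * x ∈ H := by
    intro h x
    rw [eq_comm, MulAction.Quotient.smul_coe, QuotientGroup.eq, smul_eq_mul, mul_assoc]
  have fix_coset : ∀ h ∈ H, h ≠ 1 → ∀ x : G, h • (x : G ⧸ H) = x ↔ ∀ d ∈ Δ, x • d ∈ Δ :=
    fun h hh h1 x => (fix_iff h x).trans (conj_mem h hh h1 x)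
  have fix_le : ∀ h ∈ H, h ≠ 1 → Set.ncard {c : G ⧸ H | h • c = c} ≤ 4 := by
    intro h hh h1
    rw [← hcardΔ]
    refine Set.ncard_le_ncard_of_injOn (fun c => c.out • α) ?_ ?_
    · intro c hc
      refine (fix_coset h hh h1 c.out).1 ?_ α (by simp [hΔ])
      rwa [QuotientGroup.out_eq']
    · intro c hc c' hc' e
      have e : c.out • α = c'.out • α := e
      have hc1 := (fix_coset h hh h1 c.out).1 (by rwa [QuotientGroup.out_eq'])
      have hc2 := (fix_coset h hh h1 c'.out).1 (by rwa [QuotientGroup.out_eq'])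
      have himg : (c.out • ·) '' Δ = Δ :=
        Set.eq_of_subset_of_ncard_le (Set.image_subset_iff.2 hc1)
          (Set.ncard_image_of_injective _ (MulAction.injective c.out)).ge
      rw [← QuotientGroup.out_eq' c, ← QuotientGroup.out_eq' c', QuotientGroup.eq]
      refine stab_mem _ (fun d hd => ?_) ?_
      · have hd' := hc2 d hd
        rw [← himg] at hd'
        obtain ⟨y, hy, hyd⟩ := hd'
        have hyd : c.out • y = c'.out • d := hyd
        rwa [mul_smul, ← hyd, inv_smul_smul]
      · rw [mul_smul, ← e, inv_smul_smul]
  have card_rel : ∀ p : ℕ, p.Prime → p ∣ Nat.card H →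
      H.relIndex (MulAction.stabilizer G α) ≡ 1 [MOD p] := by
    intro p hp hpd
    obtain ⟨h, hh, h1, ho⟩ := exists_order p hp hpd
    set S := MulAction.stabilizer G α with hS
    have ho' : orderOf (⟨h, hHα hh⟩ : S) = p := by rw [← ho, Subgroup.orderOf_mk]
    have key := card_modEq_ncard_fixed (X := S ⧸ H.subgroupOf S) hp ho'
    have hone : {c : S ⧸ H.subgroupOf S | (⟨h, hHα hh⟩ : S) • c = c} =
        {((1 : S) : S ⧸ H.subgroupOf S)} := by
      ext c
      induction c using QuotientGroup.induction_on with
      | H x =>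
        rw [Set.mem_ofPred_eq, Set.mem_singleton_iff, eq_comm, MulAction.Quotient.smul_coe,
          QuotientGroup.eq, eq_comm (a := (x : S ⧸ H.subgroupOf S)), QuotientGroup.eq,
          smul_eq_mul, ← mul_assoc, Subgroup.mem_subgroupOf, Subgroup.mem_subgroupOf]
        simp only [Subgroup.coe_mul, Subgroup.coe_inv, inv_one, one_mul]
        constructor
        · intro hx
          exact stab_mem _ ((conj_mem h hh h1 _).1 hx) x.2
        · intro hx
          exact mul_mem (mul_mem (inv_mem hx) hh) hx
    rw [hone, Set.ncard_singleton] at key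
    exact key
  have card_quot : ∀ p : ℕ, p.Prime → p ∣ Nat.card H → Nat.card (G ⧸ H) ≡ 4 [MOD p] := by
    intro p hp hpd
    have h1 := (card_rel p hp hpd).mul (cardΩ p hp hpd)
    rwa [← MulAction.index_stabilizer_of_transitive G α, Subgroup.relIndex_mul_index hHα,
      one_mul] at h1
  have fix_eq : ∀ h ∈ H, h ≠ 1 → Set.ncard {c : G ⧸ H | h • c = c} = 4 := by
    intro h hh h1
    have hcard : Nat.card H ≠ 1 := fun e => hHne (Subgroup.card_eq_one.1 e)
    obtain ⟨p, hp, hpd⟩ := Nat.exists_prime_and_dvd hcard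
    obtain ⟨k, hk, k1, ho⟩ := exists_order p hp hpd
    have hset : {c : G ⧸ H | h • c = c} = {c : G ⧸ H | k • c = c} := by
      ext c
      induction c using QuotientGroup.induction_on with
      | H x => exact (fix_coset h hh h1 x).trans (fix_coset k hk k1 x).symm
    rw [hset]
    have hmod := (card_modEq_ncard_fixed (X := G ⧸ H) hp ho).symm.trans (card_quot p hp hpd)
    have hle := fix_le k hk k1
    have hp5 := five_le p hp hpd
    exact hmod.eq_of_lt_of_lt (by omega) (by omega)
  refine ⟨fun g g1 => ?_, Or.inr fun g hg hgH => ?_, ?_⟩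
  · rw [or_iff_not_imp_left]
    intro hne
    obtain ⟨c, hc⟩ := Set.nonempty_of_ncard_ne_zero hne
    induction c using QuotientGroup.induction_on with
    | H x =>
      have hk : x⁻¹ * g * x ∈ H := (fix_iff g x).1 hc
      have k1 : x⁻¹ * g * x ≠ 1 := by
        intro e
        apply g1
        have := congrArg (fun y => x * y * x⁻¹) e
        simpa [mul_assoc] using this
      rw [← fix_eq _ hk k1]
      have himg : {c : G ⧸ H | g • c = c} =
          (x • ·) '' {c : G ⧸ H | (x⁻¹ * g * x) • c = c} := by
        rw [Set.image_smul]
        ext c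
        rw [Set.mem_smul_set_iff_inv_smul_mem, Set.mem_ofPred_eq, Set.mem_ofPred_eq, mul_smul,
          mul_smul, smul_inv_smul, smul_left_cancel_iff]
      rw [himg, Set.ncard_image_of_injective _ (MulAction.injective x)]
  · rw [eq_bot_iff]
    rintro y ⟨hy, k, hk, rfl⟩
    rw [Subgroup.mem_bot]
    by_contra y1
    refine hgH (stab_mem g ((conj_mem _ hy y1 g).1 ?_) hg)
    simpa [mul_assoc] using hk
  · refine Nat.Coprime.symm (Nat.coprime_of_dvd fun p hp hpΩ hpH => ?_)
    have h4 : p ∣ 4 := ((cardΩ p hp hpH).dvd_iff dvd_rfl).1 hpΩ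
    have := Nat.le_of_dvd (by norm_num) h4
    have := five_le p hp hpH
    omega
end

section
/- Let n ≥ 5 and let G be the alternating group on n letters. Suppose that G acts transitively, faithfully and with fixity 4 on a finite set Ω, that for some (equivalently every) α ∈ Ω the order of G_α is coprime to 6, and that α, β, γ, δ ∈ Ω are four distinct points such that the pointwise stabilizer H of Δ := {α, β, γ, δ} in G is a nontrivial subgroup. Let p be a prime dividing |H| and suppose that the Sylow p-subgroups of G are cyclic. Then n = 7, H = G_α, and |H| = 5. -/
lemma IsCyclic.mem_zpowers_of_orderOf_eq {C : Type*} [Group C] [Finite C] [IsCyclic C] {a b : C}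
    (h : orderOf a = orderOf b) : b ∈ Subgroup.zpowers a := by
  classical
  have := Fintype.ofFinite C
  have hle := IsCyclic.card_pow_eq_one_le (α := C) (orderOf_pos a)
  have hsub : (Finset.univ.filter fun x => x ∈ Subgroup.zpowers a) ⊆
      Finset.univ.filter fun x => x ^ orderOf a = 1 := by
    intro x hx
    simp only [Finset.mem_filter, Finset.mem_univ, true_and] at hx ⊢
    exact orderOf_dvd_iff_pow_eq_one.mp (orderOf_dvd_of_mem_zpowers hx)
  have hcard : (Finset.univ.filter fun x => x ∈ Subgroup.zpowers a).card = orderOf a := by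
    rw [← Nat.card_zpowers, Nat.card_eq_fintype_card, Fintype.card_subtype]
  have heq := Finset.eq_of_subset_of_card_le hsub (hle.trans hcard.ge)
  have hb : b ∈ Finset.univ.filter fun x => x ^ orderOf a = 1 := by
    simp [h, pow_orderOf_eq_one]
  rw [← heq] at hb
  simpa using hb

lemma Commute.mem_zpowers_of_isCyclic_sylow {G : Type*} [Group G] [Finite G] {p : ℕ}
    [Fact p.Prime] (hcyc : ∀ S : Sylow p G, IsCyclic S) {a b : G} (hab : Commute a b)
    (ha : orderOf a = p) (hb : orderOf b = p) : b ∈ Subgroup.zpowers a := by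
  have hA : IsPGroup p (Subgroup.zpowers a) :=
    IsPGroup.of_card (n := 1) (by rw [Nat.card_zpowers, ha, pow_one])
  have hB : IsPGroup p (Subgroup.zpowers b) :=
    IsPGroup.of_card (n := 1) (by rw [Nat.card_zpowers, hb, pow_one])
  have hAB : IsPGroup p ↥(Subgroup.zpowers a ⊔ Subgroup.zpowers b) := by
    refine hA.to_sup_of_normal_left' hB ?_
    refine le_trans ?_ (Subgroup.centralizer_le_normalizer _)
    rw [Subgroup.zpowers_le, Subgroup.mem_centralizer_iff]
    rintro _ ⟨k, rfl⟩
    exact (hab.zpow_left k).eq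
  obtain ⟨S, hS⟩ := hAB.exists_le_sylow
  have haS : a ∈ (S : Subgroup G) := hS (Subgroup.mem_sup_left (Subgroup.mem_zpowers a))
  have hbS : b ∈ (S : Subgroup G) := hS (Subgroup.mem_sup_right (Subgroup.mem_zpowers b))
  have := hcyc S
  obtain ⟨k, hk⟩ := IsCyclic.mem_zpowers_of_orderOf_eq (C := S) (a := ⟨a, haS⟩) (b := ⟨b, hbS⟩)
    (by rw [Subgroup.orderOf_mk, Subgroup.orderOf_mk, ha, hb])
  exact ⟨k, congrArg Subtype.val hk⟩

/-- A finite group whose Sylow `p`-subgroups have order `p` has `(p - 1) * s` elements of order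
`p`, where `s` is the number of its Sylow `p`-subgroups. -/
lemma Nat.card_orderOf_eq_prime_of_factorization_eq_one {G : Type*} [Group G] [Finite G] {p : ℕ}
    [hp : Fact p.Prime] (h : (Nat.card G).factorization p = 1) :
    Nat.card {g : G // orderOf g = p} = (p - 1) * Nat.card (Sylow p G) := by
  classical
  have hcard (S : Sylow p G) : Nat.card S = p := by rw [S.card_eq_multiplicity, h, pow_one]
  let f : {g : G // orderOf g = p} → Sylow p G := fun g =>
    Sylow.ofCard (Subgroup.zpowers g.1) (by rw [Nat.card_zpowers, g.2, h, pow_one])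
  have hf (g : {g : G // orderOf g = p}) (S : Sylow p G) : f g = S ↔ g.1 ∈ (S : Subgroup G) := by
    constructor
    · rintro rfl
      exact Subgroup.mem_zpowers g.1
    · intro hg
      apply Sylow.ext
      change Subgroup.zpowers g.1 = S
      apply Subgroup.eq_of_le_of_card_ge
      · rwa [Subgroup.zpowers_le]
      · rw [Nat.card_zpowers, g.2]
        exact (hcard S).le
  have e (S : Sylow p G) : {g // f g = S} ≃ {x : S // x ≠ 1} :=
    { toFun := fun g => ⟨⟨g.1.1, (hf g.1 S).mp g.2⟩, fun h1 => by
        have h2 : (g.1 : G) = 1 := congrArg Subtype.val h1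
        have := g.1.2
        rw [h2, orderOf_one] at this
        exact hp.out.ne_one this.symm⟩
      invFun := fun x => ⟨⟨x.1.1, by
        rw [Subgroup.orderOf_coe]
        refine ((Nat.dvd_prime hp.out).mp ?_).resolve_left (by simpa using x.2)
        exact (orderOf_dvd_natCard x.1).trans (hcard S).dvd⟩, (hf _ S).mpr x.1.2⟩
      left_inv := fun _ => rfl
      right_inv := fun _ => rfl }
  have := Fintype.ofFinite G
  have := Fintype.ofFinite (Sylow p G)
  rw [Nat.card_congr (Equiv.sigmaFiberEquiv f).symm, Nat.card_sigma]
  have hfib (S : Sylow p G) : Nat.card {g // f g = S} = p - 1 := by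
    rw [Nat.card_congr (e S), Nat.card_eq_fintype_card, Fintype.card_subtype_compl,
      Fintype.card_subtype_eq, ← Nat.card_eq_fintype_card]
    exact congrArg (· - 1) (hcard S)
  rw [Finset.sum_congr rfl (fun S _ => hfib S)]
  simp [mul_comm]

lemma MulAction.ncard_fixed_eq_of_factorization_eq_one {G Ω : Type*} [Group G] [Finite G]
    [MulAction G Ω] {p : ℕ} [Fact p.Prime] (h : (Nat.card G).factorization p = 1) {a b : G}
    (ha : orderOf a = p) (hb : orderOf b = p) :
    {ω : Ω | a • ω = ω}.ncard = {ω : Ω | b • ω = ω}.ncard := by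
  have key (g : G) (ω : Ω) : g • ω = ω ↔ Subgroup.zpowers g ≤ MulAction.stabilizer G ω := by
    rw [Subgroup.zpowers_le, MulAction.mem_stabilizer_iff]
  let A : Sylow p G := Sylow.ofCard (Subgroup.zpowers a) (by rw [Nat.card_zpowers, ha, h, pow_one])
  let B : Sylow p G := Sylow.ofCard (Subgroup.zpowers b) (by rw [Nat.card_zpowers, hb, h, pow_one])
  obtain ⟨c, hc⟩ := MulAction.exists_smul_eq G A B
  have hc' : Subgroup.zpowers (c * a * c⁻¹) = Subgroup.zpowers b := by
    have h1 : (Subgroup.zpowers a).map (MulAut.conj c).toMonoidHom = Subgroup.zpowers b :=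
      congrArg Sylow.toSubgroup hc
    rw [← h1, MonoidHom.map_zpowers]
    rfl
  have himg : {ω : Ω | b • ω = ω} = (c • ·) '' {ω : Ω | a • ω = ω} := by
    ext ω
    change b • ω = ω ↔ _
    rw [key, ← hc', ← key, mul_smul, mul_smul, ← eq_inv_smul_iff]
    refine ⟨fun h => ⟨c⁻¹ • ω, h, smul_inv_smul c ω⟩, ?_⟩
    rintro ⟨ω, h, rfl⟩
    change a • ω = ω at h
    simp [h]
  rw [himg, Set.ncard_image_of_injective _ (MulAction.injective c)]

/-- Double counting of the pairs `(g, ω)` with `g` of order `p` and `g • ω = ω`. -/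
lemma MulAction.mul_card_orderOf_eq {G Ω : Type*} [Group G] [Finite G] [Finite Ω]
    [MulAction G Ω] [MulAction.IsPretransitive G Ω] {p f : ℕ}
    (hf : ∀ g : G, orderOf g = p → {ω : Ω | g • ω = ω}.ncard = f) (α : Ω) :
    Nat.card {g : G // orderOf g = p} * f =
      Nat.card Ω * Nat.card {g : MulAction.stabilizer G α // orderOf g = p} := by
  have e1 : (Σ g : {g : G // orderOf g = p}, {ω : Ω // g.1 • ω = ω}) ≃
      Σ ω : Ω, {g : MulAction.stabilizer G ω // orderOf g = p} :=
    { toFun := fun x => ⟨x.2.1, ⟨⟨x.1.1, x.2.2⟩, (Subgroup.orderOf_mk _ _).trans x.1.2⟩⟩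
      invFun := fun x => ⟨⟨x.2.1.1, (Subgroup.orderOf_coe _).trans x.2.2⟩, ⟨x.1, x.2.1.2⟩⟩
      left_inv := fun _ => rfl
      right_inv := fun _ => rfl }
  have e2 (ω : Ω) : Nat.card {g : MulAction.stabilizer G ω // orderOf g = p} =
      Nat.card {g : MulAction.stabilizer G α // orderOf g = p} := by
    obtain ⟨c, rfl⟩ := MulAction.exists_smul_eq G α ω
    let e := MulAction.stabilizerEquivStabilizer (g := c) (a := α) (b := c • α) rfl
    exact (Nat.card_congr (e.toEquiv.subtypeEquiv fun g => by
      change _ ↔ orderOf (e g) = p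
      rw [MulEquiv.orderOf_eq])).symm
  have := Fintype.ofFinite G
  have := Fintype.ofFinite Ω
  have := Fintype.ofFinite {g : G // orderOf g = p}
  have h := Nat.card_congr e1
  rw [Nat.card_sigma, Nat.card_sigma] at h
  simp only [e2, Finset.sum_const, smul_eq_mul, Finset.card_univ] at h
  rw [Nat.card_eq_fintype_card (α := Ω), ← h, Finset.sum_congr rfl (fun g _ => hf g.1 g.2)]
  simp

lemma MulAction.not_twelve_dvd_card_centralizer {G Ω : Type*} [Group G] [Finite G] [Finite Ω]
    [MulAction G Ω] {x : G} {α : Ω} (hx : x • α = α) (hfix : {ω : Ω | x • ω = ω}.ncard ≤ 4)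
    (hcop : (Nat.card (MulAction.stabilizer G α)).Coprime 6) :
    ¬ 12 ∣ Nat.card (Subgroup.centralizer {x}) := by
  intro h12
  let C := Subgroup.centralizer {x}
  have hos : Nat.card (MulAction.orbit C α) * Nat.card (MulAction.stabilizer C α) = Nat.card C := by
    rw [← Nat.card_prod]
    exact Nat.card_congr (MulAction.orbitProdStabilizerEquivGroup C α)
  have hst : Nat.card (MulAction.stabilizer C α) ∣ Nat.card (MulAction.stabilizer G α) := by
    have hle : (MulAction.stabilizer C α).map C.subtype ≤ MulAction.stabilizer G α := by
      rintro _ ⟨c, hc, rfl⟩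
      exact hc
    have := Subgroup.card_dvd_of_le hle
    rwa [Subgroup.card_map_of_injective C.subtype_injective] at this
  have hco : Nat.Coprime 12 (Nat.card (MulAction.stabilizer C α)) := by
    have h6 := (hcop.coprime_dvd_left hst).symm
    exact (Nat.Coprime.pow_left 2 h6).coprime_dvd_left (by norm_num)
  have hdvd : 12 ∣ Nat.card (MulAction.orbit C α) :=
    hco.dvd_of_dvd_mul_right (hos ▸ h12)
  have hsub : MulAction.orbit C α ⊆ {ω : Ω | x • ω = ω} := by
    rintro _ ⟨c, rfl⟩
    have hc := Subgroup.mem_centralizer_singleton_iff.mp c.2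
    change x • (c : G) • α = (c : G) • α
    rw [← mul_smul, ← hc, mul_smul, hx]
  have hle := Set.ncard_le_ncard hsub (Set.toFinite _)
  have hne : 0 < (MulAction.orbit C α).ncard :=
    (Set.ncard_pos (Set.toFinite _)).mpr (MulAction.nonempty_orbit α)
  rw [Nat.card_coe_set_eq] at hdvd
  have := Nat.le_of_dvd hne hdvd
  omega

lemma alternatingGroup.card_centralizer_dvd {α : Type*} [Fintype α] [DecidableEq α] [Nontrivial α]
    (x : alternatingGroup α) : Nat.card (Subgroup.centralizer {(x : Equiv.Perm α)}) ∣
      2 * Nat.card (Subgroup.centralizer {x}) := by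
  set K := Subgroup.centralizer {(x : Equiv.Perm α)}
  have h1 : Subgroup.centralizer {x} = K.subgroupOf (alternatingGroup α) := by
    ext g
    simp only [K, Subgroup.mem_subgroupOf, Subgroup.mem_centralizer_singleton_iff]
    exact Subtype.ext_iff
  have h2 : Nat.card (Subgroup.centralizer {x}) = Nat.card ((alternatingGroup α).subgroupOf K) := by
    rw [h1, ← Subgroup.card_map_of_injective (alternatingGroup α).subtype_injective,
      ← Subgroup.card_map_of_injective K.subtype_injective, Subgroup.subgroupOf_map_subtype,
      Subgroup.subgroupOf_map_subtype, inf_comm]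
  rw [h2, ← Subgroup.index_mul_card ((alternatingGroup α).subgroupOf K)]
  refine mul_dvd_mul_right ?_ _
  have := Subgroup.relIndex_dvd_index_of_normal (alternatingGroup α) K
  rwa [alternatingGroup.index_eq_two] at this

open scoped Nat in
lemma alternatingGroup.exists_cycleType_eq_replicate {n r : ℕ} (hn : 2 ≤ n)
    {x : alternatingGroup (Fin n)} (hr : r.Prime) (hx : orderOf x = r)
    (h12 : ¬ 12 ∣ Nat.card (Subgroup.centralizer {x})) :
    ∃ m, (x : Equiv.Perm (Fin n)).cycleType = Multiset.replicate (m + 1) r ∧ m < 3 ∧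
      n ≤ (m + 1) * r + 3 := by
  have : Nontrivial (Fin n) := Fin.nontrivial_iff_two_le.mpr hn
  have hx' : orderOf (x : Equiv.Perm (Fin n)) = r := (Subgroup.orderOf_coe x).trans hx
  obtain ⟨m, hm⟩ := Equiv.Perm.cycleType_prime_order (hx' ▸ hr)
  rw [hx'] at hm
  have hcard := Equiv.Perm.nat_card_centralizer (x : Equiv.Perm (Fin n))
  rw [hm] at hcard
  simp only [Fintype.card_fin, Multiset.sum_replicate, Multiset.prod_replicate, smul_eq_mul,
    Multiset.toFinset_replicate, Nat.succ_ne_zero, if_false, Finset.prod_singleton,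
    Multiset.count_replicate_self] at hcard
  have h24 : ¬ 24 ∣ Nat.card (Subgroup.centralizer {(x : Equiv.Perm (Fin n))}) := fun h =>
    h12 ((Nat.mul_dvd_mul_iff_left (a := 2) two_pos).mp
      (h.trans (alternatingGroup.card_centralizer_dvd x)))
  rw [hcard] at h24
  refine ⟨m, hm, ?_, ?_⟩
  · by_contra! hlt
    exact h24 (((Nat.factorial_dvd_factorial (show 4 ≤ m + 1 by omega))).mul_left _)
  · by_contra! hlt
    exact h24 (((Nat.factorial_dvd_factorial
      (show 4 ≤ n - (m + 1) * r by omega)).mul_right _).mul_right _)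

lemma alternatingGroup.cycleType_eq_singleton_of_isCyclic_sylow {α : Type*} [Fintype α]
    [DecidableEq α] {p : ℕ} [hp : Fact p.Prime] (hp2 : p ≠ 2)
    (hcyc : ∀ S : Sylow p (alternatingGroup α), IsCyclic S) {x : alternatingGroup α}
    (hx : orderOf x = p) : (x : Equiv.Perm α).cycleType = {p} := by
  have hx' : orderOf (x : Equiv.Perm α) = p := (Subgroup.orderOf_coe x).trans hx
  obtain ⟨m, hm⟩ := Equiv.Perm.cycleType_prime_order (hx' ▸ hp.out)
  rw [hx'] at hm
  have hx1 : (x : Equiv.Perm α) ≠ 1 := by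
    rw [Ne, ← Equiv.Perm.cycleType_eq_zero, hm]
    simp
  obtain ⟨a, ha⟩ := Finset.nonempty_iff_ne_empty.mpr
    (Equiv.Perm.cycleFactorsFinset_eq_empty_iff.not.mpr hx1)
  have hacyc := (Equiv.Perm.mem_cycleFactorsFinset_iff.mp ha).1
  have hasup : a.support.card = p := by
    have : a.support.card ∈ (x : Equiv.Perm α).cycleType := by
      rw [Equiv.Perm.cycleType_def]
      exact Multiset.mem_map_of_mem _ ha
    rw [hm] at this
    exact Multiset.eq_of_mem_replicate this
  have haord : orderOf a = p := hacyc.orderOf.trans hasup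
  have hamem : a ∈ alternatingGroup α := by
    rw [Equiv.Perm.mem_alternatingGroup, hacyc.sign, hasup,
      (hp.out.odd_of_ne_two hp2).neg_one_pow, neg_neg]
  have hcomm : Commute (⟨a, hamem⟩ : alternatingGroup α) x :=
    Subtype.ext (Equiv.Perm.self_mem_cycle_factors_commute ha).eq
  obtain ⟨k, hk⟩ := hcomm.mem_zpowers_of_isCyclic_sylow hcyc
    ((Subgroup.orderOf_mk _ _).trans haord) hx
  have hk' : a ^ k = (x : Equiv.Perm α) := congrArg Subtype.val hk
  have hle := Finset.card_le_card (Equiv.Perm.support_zpow_le a k)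
  rw [hk', hasup, ← Equiv.Perm.sum_cycleType, hm, Multiset.sum_replicate, smul_eq_mul] at hle
  have hm0 : m = 0 := by
    have := hp.out.pos
    by_contra h
    have : 2 * p ≤ (m + 1) * p := Nat.mul_le_mul_right p (by omega)
    omega
  rw [hm, hm0, zero_add, Multiset.replicate_one]

open scoped Nat in
lemma alternatingGroup.card_orderOf_eq_prime_mul {n p : ℕ} (hp : p.Prime) (hp2 : p ≠ 2)
    (hpn : p ≤ n) (hn : n < 2 * p) :
    Nat.card {g : alternatingGroup (Fin n) // orderOf g = p} * (p * (n - p)!) = n ! := by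
  have key (g : alternatingGroup (Fin n)) :
      orderOf g = p ↔ (g : Equiv.Perm (Fin n)).cycleType = {p} := by
    rw [← Subgroup.orderOf_coe]
    constructor
    · intro h
      obtain ⟨m, hm⟩ := Equiv.Perm.cycleType_prime_order (h ▸ hp)
      rw [h] at hm
      have hle := Finset.card_le_univ (g : Equiv.Perm (Fin n)).support
      rw [← Equiv.Perm.sum_cycleType, hm, Multiset.sum_replicate, smul_eq_mul,
        Fintype.card_fin] at hle
      have hm0 : m = 0 := by
        by_contra h
        have : 2 * p ≤ (m + 1) * p := Nat.mul_le_mul_right p (by omega)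
        omega
      rw [hm, hm0, zero_add, Multiset.replicate_one]
    · intro h
      rw [← Equiv.Perm.lcm_cycleType, h, Multiset.lcm_singleton, normalize_eq]
  have hcard := AlternatingGroup.card_of_cycleType_singleton (α := Fin n) hp.two_le (by simpa)
  rw [if_pos (hp.odd_of_ne_two hp2), Fintype.card_fin] at hcard
  rw [Nat.card_congr (Equiv.subtypeEquivRight key), Nat.card_eq_fintype_card,
    Fintype.card_subtype, hcard, ← Nat.choose_mul_factorial_mul_factorial hpn,
    ← Nat.mul_factorial_pred hp.ne_zero]
  ring

open scoped Nat in
lemma alternatingGroup.factorization_card_eq_one {n p : ℕ} (hp : p.Prime) (hp2 : p ≠ 2)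
    (hpn : p ≤ n) (hn : n < 2 * p) :
    (Nat.card (alternatingGroup (Fin n))).factorization p = 1 := by
  have : Fact p.Prime := ⟨hp⟩
  have : Nontrivial (Fin n) := Fin.nontrivial_iff_two_le.mpr (hp.two_le.trans hpn)
  have h2 := two_mul_nat_card_alternatingGroup (α := Fin n)
  rw [Nat.card_perm, Nat.card_fin] at h2
  have h3 : (n !).factorization p = 1 := by
    obtain ⟨d, rfl⟩ := Nat.exists_eq_add_of_le hpn
    have := padicValNat_factorial_mul_add (p := p) 1 (show d < p by omega)
    rw [padicValNat_factorial_mul, mul_one] at this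
    rw [Nat.factorization_def _ hp, this]
    simp
  rw [← h2, Nat.factorization_mul two_ne_zero Nat.card_pos.ne', Finsupp.add_apply,
    Nat.factorization_eq_zero_of_not_dvd (fun h => hp2 ((Nat.prime_dvd_prime_iff_eq hp
      Nat.prime_two).mp h)), zero_add] at h3
  exact h3

/-- Let `G` be the alternating group on `n ≥ 5` letters, acting
transitively, faithfully and with fixity 4 on a finite set `Ω` with point stabilizers
of order coprime to 6, and let `H ≠ 1` be the pointwise stabilizer of four distinct
points.  If `p` is a prime dividing `|H|` whose Sylow `p`-subgroups in `G` are
cyclic, then `n = 7`, `H = G_α` and `|H| = 5`. -/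
theorem stmt_19 (n : ℕ) (hn : 5 ≤ n)
    {Ω : Type*} [Finite Ω] [MulAction ↥(alternatingGroup (Fin n)) Ω]
    [MulAction.IsPretransitive ↥(alternatingGroup (Fin n)) Ω]
    [FaithfulSMul ↥(alternatingGroup (Fin n)) Ω]
    (hfix : ∀ g : ↥(alternatingGroup (Fin n)), g ≠ 1 → Set.ncard {ω : Ω | g • ω = ω} ≤ 4)
    (hfix4 : ∃ g : ↥(alternatingGroup (Fin n)), g ≠ 1 ∧ Set.ncard {ω : Ω | g • ω = ω} = 4)
    (α β γ δ : Ω)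
    (hdist : α ≠ β ∧ α ≠ γ ∧ α ≠ δ ∧ β ≠ γ ∧ β ≠ δ ∧ γ ≠ δ)
    (hcop : Nat.Coprime
      (Nat.card ↥(MulAction.stabilizer ↥(alternatingGroup (Fin n)) α)) 6)
    (H : Subgroup ↥(alternatingGroup (Fin n))) (hHne : H ≠ ⊥)
    (hH : ∀ g : ↥(alternatingGroup (Fin n)),
      g ∈ H ↔ g • α = α ∧ g • β = β ∧ g • γ = γ ∧ g • δ = δ)
    (p : ℕ) (hp : p.Prime) (hpdvd : p ∣ Nat.card ↥H)
    (hcyc : ∀ S : Sylow p ↥(alternatingGroup (Fin n)), IsCyclic ↥(S : Subgroup ↥(alternatingGroup (Fin n)))) :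
    n = 7 ∧ H = MulAction.stabilizer ↥(alternatingGroup (Fin n)) α
      ∧ Nat.card ↥H = 5 := by
  classical
  have : Fact p.Prime := ⟨hp⟩
  have : Nontrivial (Fin n) := Fin.nontrivial_iff_two_le.mpr (by omega)
  set G := ↥(alternatingGroup (Fin n))
  set T := MulAction.stabilizer G α
  have hHT : H ≤ T := fun g hg => ((hH g).mp hg).1
  have hpT : p ∣ Nat.card T := hpdvd.trans (Subgroup.card_dvd_of_le hHT)
  have hp2 : p ≠ 2 := by
    rintro rfl
    exact Nat.not_coprime_of_dvd_of_dvd one_lt_two hpT (by norm_num) hcop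
  have hcent {x : G} (hx : x ∈ T) (hx1 : x ≠ 1) :=
    MulAction.not_twelve_dvd_card_centralizer (MulAction.mem_stabilizer_iff.mp hx)
      (hfix x hx1) hcop
  obtain ⟨⟨h, hh⟩, hord⟩ := exists_prime_orderOf_dvd_card' (G := H) p hpdvd
  rw [Subgroup.orderOf_mk] at hord
  have hne {x : G} {r : ℕ} (hr : r.Prime) (hx : orderOf x = r) : x ≠ 1 := by
    rintro rfl
    rw [orderOf_one] at hx
    exact hr.ne_one hx.symm
  have hfixh : {ω : Ω | h • ω = ω}.ncard = 4 := by
    refine le_antisymm (hfix h (hne hp hord)) ?_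
    obtain ⟨h1, h2, h3, h4⟩ := (hH h).mp hh
    obtain ⟨d1, d2, d3, d4, d5, d6⟩ := hdist
    have hcard : ({α, β, γ, δ} : Finset Ω).card = 4 := by
      rw [Finset.card_insert_of_notMem (by simp [d1, d2, d3]),
        Finset.card_insert_of_notMem (by simp [d4, d5]), Finset.card_pair d6]
    rw [← hcard, ← Set.ncard_coe_finset]
    refine Set.ncard_le_ncard ?_ (Set.toFinite _)
    intro ω hω
    simp only [Finset.coe_insert, Finset.coe_singleton, Set.mem_insert_iff,
      Set.mem_singleton_iff] at hω
    rcases hω with rfl | rfl | rfl | rfl <;> assumption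
  have hp5 : 5 ≤ p := by
    have h3 : p ≠ 3 := by
      rintro rfl
      exact Nat.not_coprime_of_dvd_of_dvd (by norm_num) hpT (by norm_num) hcop
    have h4 : p ≠ 4 := by
      rintro rfl
      revert hp
      norm_num
    have := hp.two_le
    omega
  have hct := alternatingGroup.cycleType_eq_singleton_of_isCyclic_sylow hp2 hcyc hord
  have hpn : p ≤ n := by
    have hle := Finset.card_le_univ (h : Equiv.Perm (Fin n)).support
    rwa [← Equiv.Perm.sum_cycleType, hct, Multiset.sum_singleton, Fintype.card_fin] at hle
  have hnp : n ≤ p + 3 := by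
    obtain ⟨m, hm, -, hle⟩ := alternatingGroup.exists_cycleType_eq_replicate (by omega) hp hord
      (hcent (hHT hh) (hne hp hord))
    have hm0 : 1 = m + 1 := by simpa [hct] using congrArg Multiset.card hm
    rw [← hm0] at hle
    omega
  have hG := alternatingGroup.factorization_card_eq_one hp hp2 hpn (by omega)
  have hTG : Nat.card T ∣ Nat.card G := Subgroup.card_subgroup_dvd_card T
  have hTp : (Nat.card T).factorization p = 1 := by
    refine le_antisymm (hG ▸ ?_) (hp.dvd_iff_one_le_factorization Nat.card_pos.ne' |>.mp hpT)
    exact (Nat.factorization_le_iff_dvd Nat.card_pos.ne' Nat.card_pos.ne').mpr hTG p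
  have hcount := MulAction.mul_card_orderOf_eq (f := 4) (p := p) (fun g hg =>
    (MulAction.ncard_fixed_eq_of_factorization_eq_one hG hg hord).trans hfixh) α
  rw [Nat.card_orderOf_eq_prime_of_factorization_eq_one hTp] at hcount
  have hcountG := alternatingGroup.card_orderOf_eq_prime_mul hp hp2 hpn (by omega)
  have hGn : 2 * Nat.card G = n.factorial := by
    have h2 := two_mul_nat_card_alternatingGroup (α := Fin n)
    rwa [Nat.card_perm, Nat.card_fin] at h2
  have hΩT : Nat.card Ω * Nat.card T = Nat.card G := by
    rw [← MulAction.index_stabilizer_of_transitive G α, Subgroup.index_mul_card]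
  have hΩ : 0 < Nat.card Ω := Nat.card_pos_iff.mpr ⟨⟨α⟩, inferInstance⟩
  set s := Nat.card (Sylow p T) with hs
  have hmain : 8 * Nat.card T = p * (p - 1) * (n - p).factorial * s := by
    apply Nat.eq_of_mul_eq_mul_left hΩ
    calc Nat.card Ω * (8 * Nat.card T) = 4 * n.factorial := by rw [← hGn, ← hΩT]; ring
      _ = (Nat.card {g : G // orderOf g = p} * 4) * (p * (n - p).factorial) := by
        rw [← hcountG]; ring
      _ = _ := by rw [hcount]; ring
  obtain ⟨P⟩ := (inferInstance : Nonempty (Sylow p T))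
  have hspos : 0 < s := Nat.card_pos
  obtain ⟨k, hk⟩ : ∃ k, Nat.card T = s * (p * k) := by
    have hdvd : Nat.card P ∣ Nat.card (Subgroup.normalizer (P : Set T)) :=
      Subgroup.card_dvd_of_le Subgroup.le_normalizer
    rw [P.card_eq_multiplicity, hTp, pow_one] at hdvd
    obtain ⟨k, hk⟩ := hdvd
    refine ⟨k, ?_⟩
    rw [← hk, hs, P.card_eq_index_normalizer]
    exact (Subgroup.index_mul_card _).symm
  have h8k : 8 * k = (p - 1) * (n - p).factorial := by
    apply Nat.eq_of_mul_eq_mul_left (Nat.mul_pos hspos hp.pos)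
    calc s * p * (8 * k) = 8 * Nat.card T := by rw [hk]; ring
      _ = _ := by rw [hmain]; ring
  have hkT : k ∣ Nat.card T := ⟨s * p, by rw [hk]; ring⟩
  have hk6 : k.Coprime 6 := hcop.coprime_dvd_left hkT
  have hnp2 : n ≤ p + 2 := by
    by_contra! hlt
    have h3 : n - p = 3 := by omega
    rw [h3] at h8k
    have h3k : 3 ∣ k := (Nat.Coprime.dvd_of_dvd_mul_left (by norm_num : Nat.Coprime 3 8)
      (h8k ▸ Dvd.dvd.mul_left (by decide) _))
    exact Nat.not_coprime_of_dvd_of_dvd (by norm_num) h3k (by norm_num) hk6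
  have hfac : (n - p).factorial = 1 ∨ n = p + 2 ∧ (n - p).factorial = 2 := by
    obtain h | h | h : n - p = 0 ∨ n - p = 1 ∨ n - p = 2 := by omega
    · simp [h]
    · simp [h]
    · exact Or.inr ⟨by omega, by simp [h]⟩
  have hk1 : k = 1 := by
    by_contra hk1
    have hr := Nat.minFac_prime hk1
    have hrk := k.minFac_dvd
    set r := k.minFac
    have hkpos : 0 < k := by
      rcases Nat.eq_zero_or_pos k with rfl | hk0
      · norm_num at hk6
      · exact hk0
    have hle := Nat.le_of_dvd hkpos hrk
    have hr2 : r ≠ 2 := fun h2 =>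
      Nat.not_coprime_of_dvd_of_dvd one_lt_two (h2 ▸ hrk) (by norm_num) hk6
    have := hr.two_le
    obtain ⟨x, hx⟩ := exists_prime_orderOf_dvd_card' (hp := ⟨hr⟩) r (hrk.trans hkT)
    have hx' : orderOf (x : G) = r := (Subgroup.orderOf_coe x).trans hx
    obtain ⟨m, -, hm, hle'⟩ := alternatingGroup.exists_cycleType_eq_replicate (by omega) hr hx'
      (hcent x.2 (hne hr hx'))
    have hmr : (m + 1) * r ≤ 3 * r := Nat.mul_le_mul_right r (by omega)
    rcases hfac with hf | ⟨-, hf⟩ <;> rw [hf] at h8k <;> omega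
  obtain ⟨rfl, rfl⟩ : p = 5 ∧ n = 7 := by
    rw [hk1] at h8k
    rcases hfac with hf | ⟨hn2, hf⟩ <;> rw [hf] at h8k
    · have : p = 9 := by omega
      rw [this] at hp
      norm_num at hp
    · omega
  have hs1 : s = 1 := by
    have h1 : Nat.card T ∣ 72 * 35 := by
      have : Nat.card G = 72 * 35 := by
        have : Nat.factorial 7 = 5040 := rfl
        omega
      exact this ▸ hTG
    have h72 : (Nat.card T).Coprime 72 :=
      (hcop.pow_right 3).coprime_dvd_right (by norm_num)
    have h35 := h72.dvd_of_dvd_mul_left h1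
    have hs7 : s ∣ 7 := by
      rw [hk, hk1] at h35
      exact Nat.dvd_of_mul_dvd_mul_right (k := 5) (by norm_num) (by simpa using h35)
    rcases (Nat.dvd_prime (by norm_num)).mp hs7 with h | h
    · exact h
    · have hmod := card_sylow_modEq_one 5 T
      rw [← hs, h] at hmod
      exact absurd hmod (by decide)
  have hT5 : Nat.card T = 5 := by rw [hk, hs1, hk1]
  have hHT' : H = T := by
    refine Subgroup.eq_of_le_of_card_ge hHT ?_
    rw [hT5]
    exact Nat.le_of_dvd Nat.card_pos hpdvd
  exact ⟨rfl, hHT', hHT' ▸ hT5⟩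
end
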